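/- arXiv:2503.21022 — 13 statements merged into one kernel-verified Lean document; each statement's English description precedes it below -/
import Mathlib

section
/- Let f, g : G → ℂ and let n ≥ 1. Then M_n(f; x_1,…,x_{n−1}) = M_n(g; x_1,…,x_{n−1}) for all x_1,…,x_{n−1} ∈ G if and only if f̂(x_1)·f̂(x_2)⋯f̂(x_n) = ĝ(x_1)·ĝ(x_2)⋯ĝ(x_n) for all x_1,…,x_n ∈ G with x_1+⋯+x_n = 0. -/
open Complex Finset

/-- The character `χ(x,y) = exp(2πi·Σ_i x_i·y_i/a_i)` on `G = ∏_i ℤ/a_iℤ`. -/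
noncomputable def gchar {r : ℕ} (a : Fin r → ℕ) (x y : ∀ i, ZMod (a i)) : ℂ :=
  Complex.exp (2 * Real.pi * Complex.I *
    ∑ i, ((x i).val : ℂ) * ((y i).val : ℂ) / (a i : ℂ))

/-- The discrete Fourier transform `f̂(x) = Σ_y f(y)·exp(−2πi·Σ_i x_i·y_i/a_i)`. -/
noncomputable def gdft {r : ℕ} (a : Fin r → ℕ) [∀ i, NeZero (a i)]
    (f : (∀ i, ZMod (a i)) → ℂ) (x : ∀ i, ZMod (a i)) : ℂ :=
  ∑ y : ∀ i, ZMod (a i), f y * Complex.exp (-(2 * Real.pi * Complex.I *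
    ∑ i, ((x i).val : ℂ) * ((y i).val : ℂ) / (a i : ℂ)))

/-- `autocorr f (x_1,…,x_m)` is the `(m+1)`-st order autocorrelation
`M_{m+1}(f; x_1,…,x_m) = Σ_y f(y)·f(y+x_1)⋯f(y+x_m)`. -/
noncomputable def autocorr {G : Type*} [AddCommGroup G] [Fintype G]
    (f : G → ℂ) {m : ℕ} (x : Fin m → G) : ℂ :=
  ∑ y, f y * ∏ j, f (y + x j)

/-- The pairing `(x, y) ↦ exp(-2πi·Σ_i x_i·y_i/a_i)`, as an additive character in `y`. -/
noncomputable def dftChar {r : ℕ} (a : Fin r → ℕ) [∀ i, NeZero (a i)]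
    (x : ∀ i, ZMod (a i)) : AddChar (∀ i, ZMod (a i)) ℂ where
  toFun y := ∏ i, ZMod.stdAddChar (-(x i * y i))
  map_zero_eq_one' := by simp
  map_add_eq_mul' y z := by
    simp only [Pi.add_apply, mul_add, neg_add, AddChar.map_add_eq_mul, Finset.prod_mul_distrib]

section dftChar

variable {r : ℕ} (a : Fin r → ℕ) [∀ i, NeZero (a i)]

theorem dftChar_apply (x y : ∀ i, ZMod (a i)) :
    dftChar a x y = ∏ i, ZMod.stdAddChar (-(x i * y i)) := rfl

theorem dftChar_comm (x y : ∀ i, ZMod (a i)) : dftChar a x y = dftChar a y x := by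
  simp only [dftChar_apply, mul_comm]

theorem dftChar_eq_exp (x y : ∀ i, ZMod (a i)) :
    dftChar a x y = Complex.exp (-(2 * Real.pi * Complex.I *
      ∑ i, ((x i).val : ℂ) * ((y i).val : ℂ) / (a i : ℂ))) := by
  rw [dftChar_apply, Finset.mul_sum, ← Finset.sum_neg_distrib, Complex.exp_sum]
  refine Finset.prod_congr rfl fun i _ => ?_
  have h : -(x i * y i) = ((-((x i).val * (y i).val : ℤ) : ℤ) : ZMod (a i)) := by
    push_cast
    simp
  rw [h, ZMod.stdAddChar_coe]
  congr 1
  push_cast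
  ring

theorem gdft_eq_sum_dftChar (f : (∀ i, ZMod (a i)) → ℂ) (x : ∀ i, ZMod (a i)) :
    gdft a f x = ∑ y, f y * dftChar a x y := by
  simp only [gdft, dftChar_eq_exp]

theorem dftChar_eq_zero_iff (x : ∀ i, ZMod (a i)) : dftChar a x = 0 ↔ x = 0 := by
  constructor
  · intro h
    ext1 i
    have hi := DFunLike.congr_fun h (Pi.single i 1)
    rw [dftChar_apply, Finset.prod_eq_single i] at hi
    · have := ZMod.injective_stdAddChar (N := a i)
        (hi.trans (AddChar.map_zero_eq_one ZMod.stdAddChar).symm)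
      simpa using this
    · intro j _ hj
      simp [Pi.single_eq_of_ne hj]
    · simp
  · rintro rfl
    ext y
    simp [dftChar_apply]

theorem sum_dftChar (y : ∀ i, ZMod (a i)) :
    ∑ k, dftChar a k y = if y = 0 then (Fintype.card (∀ i, ZMod (a i)) : ℂ) else 0 := by
  classical
  simp only [dftChar_comm a _ y, AddChar.sum_eq_ite, dftChar_eq_zero_iff]

theorem sum_prod_dftChar {m : ℕ} (z : Fin m → ∀ i, ZMod (a i)) :
    ∑ k : Fin m → ∀ i, ZMod (a i), ∏ j, dftChar a (k j) (z j) =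
      if z = 0 then (Fintype.card (∀ i, ZMod (a i)) : ℂ) ^ m else 0 := by
  rw [← Fintype.prod_sum fun j (k : ∀ i, ZMod (a i)) => dftChar a k (z j)]
  simp only [sum_dftChar]
  split_ifs with h
  · simp [h]
  · obtain ⟨j, hj⟩ := Function.ne_iff.mp h
    exact Finset.prod_eq_zero (Finset.mem_univ j) (if_neg hj)

/-- The Fourier transform on `G^m` is injective. -/
theorem eq_of_sum_mul_prod_dftChar_eq {m : ℕ} {F H : (Fin m → ∀ i, ZMod (a i)) → ℂ}
    (h : ∀ k : Fin m → ∀ i, ZMod (a i),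
      ∑ x, F x * ∏ j, dftChar a (k j) (x j) = ∑ x, H x * ∏ j, dftChar a (k j) (x j)) :
    F = H := by
  have inversion (F : (Fin m → ∀ i, ZMod (a i)) → ℂ) (z : Fin m → ∀ i, ZMod (a i)) :
      ∑ k : Fin m → ∀ i, ZMod (a i),
        (∑ x, F x * ∏ j, dftChar a (k j) (x j)) * ∏ j, dftChar a (k j) (-z j) =
      F z * (Fintype.card (∀ i, ZMod (a i)) : ℂ) ^ m := by
    simp only [Finset.sum_mul, mul_assoc, ← Finset.prod_mul_distrib, ← AddChar.map_add_eq_mul]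
    rw [Finset.sum_comm]
    simp only [← Finset.mul_sum]
    rw [Finset.sum_eq_single z]
    · rw [sum_prod_dftChar a fun j => z j + -z j, if_pos (by ext1 j; simp)]
    · intro x _ hx
      rw [sum_prod_dftChar a fun j => x j + -z j, if_neg, mul_zero]
      intro h0
      exact hx (funext fun j => add_neg_eq_zero.mp (congrFun h0 j))
    · simp
  ext z
  refine mul_right_cancel₀ (pow_ne_zero m (Nat.cast_ne_zero.mpr
    (Fintype.card_ne_zero (α := ∀ i, ZMod (a i))))) ?_
  rw [← inversion F z, ← inversion H z]
  simp only [h]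

/-- The Fourier transform of the autocorrelation is a product of values of `f̂`. -/
theorem sum_autocorr_mul_prod_dftChar (f : (∀ i, ZMod (a i)) → ℂ) {m : ℕ}
    (k : Fin m → ∀ i, ZMod (a i)) :
    ∑ x, autocorr f x * ∏ j, dftChar a (k j) (x j) =
      gdft a f (-∑ j, k j) * ∏ j, gdft a f (k j) := by
  have shift (y k : ∀ i, ZMod (a i)) :
      ∑ x, f (y + x) * dftChar a k x = dftChar a k (-y) * gdft a f k := by
    rw [gdft_eq_sum_dftChar, Finset.mul_sum]
    refine Fintype.sum_equiv (Equiv.addLeft y) _ _ fun x => ?_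
    have hx : dftChar a k x = dftChar a k (-y) * dftChar a k (y + x) := by
      rw [← AddChar.map_add_eq_mul, neg_add_cancel_left]
    rw [Equiv.coe_addLeft, hx]
    ring
  have phase (y : ∀ i, ZMod (a i)) :
      ∏ j, dftChar a (k j) (-y) = dftChar a (-∑ j, k j) y := by
    rw [dftChar_comm a _ y, ← Finset.sum_neg_distrib]
    refine Eq.symm <| (map_prod (dftChar a y).toMonoidHom
      (fun j => Multiplicative.ofAdd (-k j)) Finset.univ).trans ?_
    refine Finset.prod_congr rfl fun j _ => ?_
    change dftChar a y (-k j) = _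
    simp [dftChar_apply, mul_comm]
  simp only [autocorr, Finset.sum_mul, mul_assoc, ← Finset.prod_mul_distrib]
  rw [Finset.sum_comm]
  simp only [← Finset.mul_sum]
  rw [gdft_eq_sum_dftChar, Finset.sum_mul]
  refine Finset.sum_congr rfl fun y _ => ?_
  rw [← Fintype.prod_sum fun j (x : ∀ i, ZMod (a i)) => f (y + x) * dftChar a (k j) x]
  simp only [shift, Finset.prod_mul_distrib, phase, mul_assoc]

end dftChar

theorem stmt2 {r : ℕ} (hr : 1 ≤ r) (a : Fin r → ℕ) [∀ i, NeZero (a i)]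
    (f g : (∀ i, ZMod (a i)) → ℂ) (n : ℕ) (hn : 1 ≤ n) :
    (∀ x : Fin (n - 1) → ∀ i, ZMod (a i), autocorr f x = autocorr g x) ↔
      ∀ x : Fin n → ∀ i, ZMod (a i), ∑ j, x j = 0 →
        ∏ j, gdft a f (x j) = ∏ j, gdft a g (x j) := by
  obtain ⟨m, rfl⟩ : ∃ m, n = m + 1 := ⟨n - 1, by omega⟩
  change (∀ x : Fin m → ∀ i, ZMod (a i), autocorr f x = autocorr g x) ↔ _
  constructor
  · intro h x hx
    rw [Fin.sum_univ_succ] at hx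
    rw [Fin.prod_univ_succ, Fin.prod_univ_succ, eq_neg_of_add_eq_zero_left hx,
      ← sum_autocorr_mul_prod_dftChar, ← sum_autocorr_mul_prod_dftChar]
    exact Finset.sum_congr rfl fun z _ => by rw [h z]
  · intro h x
    refine congrFun (eq_of_sum_mul_prod_dftChar_eq a fun k => ?_) x
    rw [sum_autocorr_mul_prod_dftChar, sum_autocorr_mul_prod_dftChar]
    simpa [Fin.prod_univ_succ] using
      h (Fin.cons (-∑ j, k j) k) (by simp [Fin.sum_univ_succ])
end

section
/- Let f, g : G → ℂ have the same autocorrelations up to order 3, and suppose that f̂(x) ≠ 0 for every x ∈ G. Then there exists y ∈ G such that g(x) = f(x+y) for all x ∈ G, i.e. g is a translation of f. -/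
open Complex Finset

/-- The Fourier coefficient `Σ_y f(y)·ψ(y)` of `f` at an additive character `ψ`. -/
noncomputable def charCoeff {G : Type*} [AddCommGroup G] [Fintype G]
    (f : G → ℂ) (ψ : AddChar G ℂ) : ℂ :=
  ∑ y, f y * ψ y

section CharCoeff

variable {G : Type*} [AddCommGroup G] [Fintype G]

lemma charCoeff_injective {f g : G → ℂ} (h : ∀ ψ, charCoeff f ψ = charCoeff g ψ) : f = g := by
  classical
  have key : Fintype.linearCombination ℂ f = Fintype.linearCombination ℂ g := by
    refine (AddChar.complexBasis G).ext fun ψ => ?_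
    simpa [Fintype.linearCombination_apply, charCoeff, mul_comm] using h ψ
  funext x
  simpa [Fintype.linearCombination_apply_single] using
    LinearMap.congr_fun key (Pi.single x 1)

lemma charCoeff_translate (f : G → ℂ) (z : G) (ψ : AddChar G ℂ) :
    charCoeff (fun x => f (x + z)) ψ = charCoeff f ψ * ψ (-z) := by
  rw [charCoeff, charCoeff, sum_mul,
    ← Equiv.sum_comp (Equiv.addRight z) (fun y => f y * ψ y * ψ (-z))]
  refine sum_congr rfl fun y _ => ?_
  rw [mul_assoc, ← AddChar.map_add_eq_mul]
  simp

lemma sum_translate_mul (f : G → ℂ) (ψ : AddChar G ℂ) (y : G) :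
    ∑ x, f (y + x) * ψ x = charCoeff f ψ * (-ψ) y := by
  rw [AddChar.neg_apply, ← charCoeff_translate]
  simp [charCoeff, add_comm]

/-- The Fourier transform of the second order autocorrelation. -/
lemma sum_autocorr_two (f : G → ℂ) (ψ : AddChar G ℂ) :
    ∑ x, autocorr f ![x] * ψ x = charCoeff f ψ * charCoeff f (-ψ) := by
  simp only [autocorr, sum_mul]
  rw [sum_comm]
  simp only [Fin.prod_univ_one, Matrix.cons_val_zero, mul_assoc]
  simp only [← mul_sum, sum_translate_mul]
  rw [show charCoeff f (-ψ) = ∑ y, f y * (-ψ) y from rfl, mul_sum]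
  exact sum_congr rfl fun y _ => by ring

/-- The Fourier transform of the third order autocorrelation (the bispectrum). -/
lemma sum_autocorr_three (f : G → ℂ) (ψ φ : AddChar G ℂ) :
    ∑ x, ∑ x', autocorr f ![x, x'] * (ψ x * φ x') =
      charCoeff f ψ * charCoeff f φ * charCoeff f (-(ψ + φ)) := by
  have key (y : G) : ∑ x, ∑ x', f y * (f (y + x) * f (y + x')) * (ψ x * φ x') =
      charCoeff f ψ * charCoeff f φ * (f y * (-(ψ + φ)) y) := by
    have e : (-(ψ + φ)) y = (-ψ) y * (-φ) y := by
      rw [neg_add, AddChar.add_apply]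
    calc _ = f y * ((∑ x, f (y + x) * ψ x) * ∑ x', f (y + x') * φ x') := by
          rw [sum_mul_sum, mul_sum]
          refine sum_congr rfl fun x _ => ?_
          rw [mul_sum]
          exact sum_congr rfl fun x' _ => by ring
      _ = _ := by rw [sum_translate_mul, sum_translate_mul, e]; ring
  rw [show charCoeff f (-(ψ + φ)) = ∑ y, f y * (-(ψ + φ)) y from rfl, mul_sum]
  simp only [← key, autocorr, sum_mul, Fin.prod_univ_two, Matrix.cons_val_zero, Matrix.cons_val_one]
  exact (sum_comm.trans (sum_congr rfl fun x _ => sum_comm)).symm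

/-- A function with nowhere vanishing Fourier transform is determined up to translation by its
autocorrelations up to order three. -/
theorem exists_translate_of_autocorr_eq {f g : G → ℂ}
    (hcorr : ∀ m : ℕ, m + 1 ≤ 3 → ∀ x : Fin m → G, autocorr f x = autocorr g x)
    (hf : ∀ ψ, charCoeff f ψ ≠ 0) :
    ∃ y, ∀ x, g x = f (x + y) := by
  have h₁ : charCoeff f 0 = charCoeff g 0 := by
    simpa [autocorr, charCoeff] using hcorr 0 (by norm_num) ![]
  have h₂ (ψ : AddChar G ℂ) :
      charCoeff f ψ * charCoeff f (-ψ) = charCoeff g ψ * charCoeff g (-ψ) := by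
    simp only [← sum_autocorr_two, hcorr 1 (by norm_num)]
  have h₃ (ψ φ : AddChar G ℂ) : charCoeff f ψ * charCoeff f φ * charCoeff f (-(ψ + φ)) =
      charCoeff g ψ * charCoeff g φ * charCoeff g (-(ψ + φ)) := by
    simp only [← sum_autocorr_three, hcorr 2 (by norm_num)]
  let η : AddChar (AddChar G ℂ) ℂ :=
    { toFun := fun ψ => charCoeff g ψ / charCoeff f ψ
      map_zero_eq_one' := by rw [← h₁, div_self (hf 0)]
      map_add_eq_mul' := fun ψ φ => by
        have hne := mul_ne_zero (hf (ψ + φ)) (hf (-(ψ + φ)))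
        have hg : charCoeff g (-(ψ + φ)) ≠ 0 := by
          rw [h₂] at hne
          exact right_ne_zero_of_mul hne
        have e₂ := h₂ (ψ + φ)
        have e₃ := h₃ ψ φ
        have := hf ψ
        have := hf φ
        have := hf (ψ + φ)
        field_simp
        refine mul_right_cancel₀ hg ?_
        linear_combination (-charCoeff f ψ * charCoeff f φ) * e₂ + charCoeff f (ψ + φ) * e₃ }
  obtain ⟨y, hy⟩ := AddChar.doubleDualEmb_bijective.2 η
  refine ⟨-y, congr_fun (charCoeff_injective (f := g) (g := fun x => f (x + -y)) fun ψ => ?_)⟩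
  have hψ : ψ y = charCoeff g ψ / charCoeff f ψ := DFunLike.congr_fun hy ψ
  rw [charCoeff_translate, neg_neg, hψ, mul_div_cancel₀ _ (hf ψ)]

end CharCoeff

lemma gchar_eq_prod {r : ℕ} (a : Fin r → ℕ) [∀ i, NeZero (a i)] (x y : ∀ i, ZMod (a i)) :
    gchar a x y = ∏ i, AddChar.zmodAddEquiv (x i) (y i) := by
  rw [gchar, mul_sum, Complex.exp_sum]
  refine prod_congr rfl fun i _ => ?_
  have := AddChar.zmod_intCast (a i) (x i).val (y i).val
  simp only [Int.cast_natCast, ZMod.natCast_zmod_val] at this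
  rw [AddChar.zmodAddEquiv_apply]
  change _ = ((AddChar.zmod (a i) (x i) (y i) : Circle) : ℂ)
  rw [this, Circle.coe_exp]
  congr 1
  push_cast
  ring

/-- Every additive character of `∏_i ℤ/a_iℤ` is of the form `χ(x,·)`. -/
lemma exists_gchar_eq {r : ℕ} (a : Fin r → ℕ) [∀ i, NeZero (a i)]
    (ψ : AddChar (∀ i, ZMod (a i)) ℂ) : ∃ x, ∀ y, gchar a x y = ψ y := by
  classical
  refine ⟨fun i => AddChar.zmodAddEquiv.symm
    (ψ.compAddMonoidHom (AddMonoidHom.single (fun i => ZMod (a i)) i)), fun y => ?_⟩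
  rw [gchar_eq_prod]
  simp only [AddEquiv.apply_symm_apply, AddChar.compAddMonoidHom_apply, AddMonoidHom.single_apply]
  have := map_prod ψ.toMonoidHom (fun i => Multiplicative.ofAdd (Pi.single i (y i))) univ
  simpa [← ofAdd_sum, Finset.univ_sum_single] using this.symm

lemma exists_gdft_eq_charCoeff {r : ℕ} (a : Fin r → ℕ) [∀ i, NeZero (a i)]
    (ψ : AddChar (∀ i, ZMod (a i)) ℂ) : ∃ x, ∀ f, gdft a f x = charCoeff f ψ := by
  obtain ⟨x, hx⟩ := exists_gchar_eq a (-ψ)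
  refine ⟨x, fun f => sum_congr rfl fun y _ => ?_⟩
  rw [Complex.exp_neg, ← gchar, hx, AddChar.neg_apply, AddChar.map_neg_eq_inv, inv_inv]

theorem stmt3 {r : ℕ} (hr : 1 ≤ r) (a : Fin r → ℕ) [∀ i, NeZero (a i)]
    (f g : (∀ i, ZMod (a i)) → ℂ)
    (hcorr : ∀ m : ℕ, m + 1 ≤ 3 → ∀ x : Fin m → ∀ i, ZMod (a i),
      autocorr f x = autocorr g x)
    (hf : ∀ x, gdft a f x ≠ 0) :
    ∃ y, ∀ x, g x = f (x + y) := by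
  refine exists_translate_of_autocorr_eq hcorr fun ψ => ?_
  obtain ⟨x, hx⟩ := exists_gdft_eq_charCoeff a ψ
  exact hx f ▸ hf x
end

section
/- Suppose N = exp(G) is odd, f : G → ℂ is rational-valued, and x ∈ G satisfies f̂(x) ≠ 0. Then f̂(2^k·x) ≠ 0 for every integer k ≥ 0, and, with φ denoting Euler's totient function, f̂(x)^{2^{φ(N)}−1} = ∏_{k=0}^{φ(N)−1} ( M̂_3(f; 2^k·x, 2^k·x) / M̂_2(f; 2^{k+1}·x) )^{2^{φ(N)−1−k}} (all the denominators being nonzero). -/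
open Complex Finset

/-- `gdftAutocorr f (x_1,…,x_m)` is the transformed autocorrelation
`M̂_{m+1}(f; x_1,…,x_m) = f̂(x_1)⋯f̂(x_m)·f̂(−x_1−⋯−x_m)`. -/
noncomputable def gdftAutocorr {r : ℕ} (a : Fin r → ℕ) [∀ i, NeZero (a i)]
    (f : (∀ i, ZMod (a i)) → ℂ) {m : ℕ} (x : Fin m → ∀ i, ZMod (a i)) : ℂ :=
  (∏ j, gdft a f (x j)) * gdft a f (-∑ j, x j)

/-- The exponential kernel of `gdft` as a product of standard additive characters. -/
lemma exp_kernel_eq_prod {r : ℕ} (a : Fin r → ℕ) [∀ i, NeZero (a i)]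
    (x y : ∀ i, ZMod (a i)) :
    Complex.exp (-(2 * Real.pi * Complex.I *
      ∑ i, ((x i).val : ℂ) * ((y i).val : ℂ) / (a i : ℂ))) =
      ∏ i, ZMod.stdAddChar (-(x i * y i)) := by
  rw [Finset.mul_sum, ← Finset.sum_neg_distrib, Complex.exp_sum]
  refine Finset.prod_congr rfl fun i _ => ?_
  have h : -(x i * y i) = ((-((x i).val * (y i).val : ℤ) : ℤ) : ZMod (a i)) := by
    push_cast
    simp only [ZMod.natCast_val, ZMod.cast_id', id]
  rw [h, ZMod.stdAddChar_coe]
  congr 1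
  push_cast
  ring

lemma gdft_eq_sum_stdAddChar {r : ℕ} (a : Fin r → ℕ) [∀ i, NeZero (a i)]
    (f : (∀ i, ZMod (a i)) → ℂ) (x : ∀ i, ZMod (a i)) :
    gdft a f x = ∑ y, f y * ∏ i, ZMod.stdAddChar (-(x i * y i)) := by
  simp only [gdft, exp_kernel_eq_prod]

lemma gdft_nsmul {r : ℕ} (a : Fin r → ℕ) [∀ i, NeZero (a i)]
    (f : (∀ i, ZMod (a i)) → ℂ) (k : ℕ) (x : ∀ i, ZMod (a i)) :
    gdft a f (k • x) = ∑ y, f y * (∏ i, ZMod.stdAddChar (-(x i * y i))) ^ k := by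
  rw [gdft_eq_sum_stdAddChar]
  refine Finset.sum_congr rfl fun y _ => ?_
  rw [← Finset.prod_pow]
  congr 1
  refine Finset.prod_congr rfl fun i _ => ?_
  rw [← AddChar.map_nsmul_eq_pow, Pi.smul_apply, smul_mul_assoc, smul_neg]

/-- A rational combination of `N`-th roots of unity which vanishes still vanishes after raising
the roots of unity to a power coprime to `N`. -/
lemma sum_mul_pow_eq_zero_of_coprime {ι : Type*} (s : Finset ι) {N k : ℕ} (hN : 0 < N)
    (hk : k.Coprime N) (q : ι → ℚ) (z : ι → ℂ) (hz : ∀ i, z i ^ N = 1)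
    (h : ∑ i ∈ s, (q i : ℂ) * z i = 0) : ∑ i ∈ s, (q i : ℂ) * z i ^ k = 0 := by
  have : NeZero N := ⟨hN.ne'⟩
  have hζ := Complex.isPrimitiveRoot_exp N hN.ne'
  set ζ : ℂ := Complex.exp (2 * Real.pi * Complex.I / N)
  choose e _ he using fun i => hζ.eq_pow_of_pow_eq_one (hz i)
  let P : Polynomial ℚ := ∑ i ∈ s, Polynomial.C (q i) * Polynomial.X ^ e i
  have hP : ∀ w : ℂ, Polynomial.aeval w P = ∑ i ∈ s, (q i : ℂ) * w ^ e i := by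
    intro w
    simp [P]
  have hdvd : minpoly ℚ (ζ ^ k) ∣ P := by
    rw [← Polynomial.cyclotomic_eq_minpoly_rat (hζ.pow_of_coprime k hk) hN,
      Polynomial.cyclotomic_eq_minpoly_rat hζ hN]
    apply minpoly.dvd
    rw [hP]
    simpa only [he] using h
  have h0 := minpoly.dvd_iff.mp hdvd
  rw [hP] at h0
  rw [← h0]
  refine Finset.sum_congr rfl fun i _ => ?_
  rw [← he i, ← pow_mul, ← pow_mul, mul_comm (e i)]

/-- For rational-valued `f`, a zero of the Fourier transform at `x` forces one at `k • x`, when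
`k` is coprime to some `N > 0` annihilating `x`. -/
lemma gdft_nsmul_eq_zero {r : ℕ} (a : Fin r → ℕ) [∀ i, NeZero (a i)]
    (f : (∀ i, ZMod (a i)) → ℂ) (hf : ∀ x, ∃ q : ℚ, f x = (q : ℂ)) {N k : ℕ} (hN : 0 < N)
    (hk : k.Coprime N) {x : ∀ i, ZMod (a i)} (hx : N • x = 0) (h : gdft a f x = 0) :
    gdft a f (k • x) = 0 := by
  choose q hq using hf
  rw [gdft_nsmul]
  simp only [hq]
  refine sum_mul_pow_eq_zero_of_coprime _ hN hk q _ (fun y => ?_) ?_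
  · rw [← Finset.prod_pow]
    refine Finset.prod_eq_one fun i _ => ?_
    rw [← AddChar.map_nsmul_eq_pow, smul_neg, ← smul_mul_assoc, ← Pi.smul_apply, hx]
    simp
  · simpa only [hq, gdft_eq_sum_stdAddChar] using h

lemma gdft_nsmul_ne_zero {r : ℕ} (a : Fin r → ℕ) [∀ i, NeZero (a i)]
    (f : (∀ i, ZMod (a i)) → ℂ) (hf : ∀ x, ∃ q : ℚ, f x = (q : ℂ)) {N k : ℕ} (hN : 0 < N)
    (hk : k.Coprime N) {x : ∀ i, ZMod (a i)} (hx : N • x = 0) (h : gdft a f x ≠ 0) :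
    gdft a f (k • x) ≠ 0 := by
  intro h0
  refine h ?_
  have hl : (k ^ (N.totient - 1)).Coprime N := hk.pow_left _
  have hx' : N • (k • x) = 0 := by rw [nsmul_left_comm, hx, smul_zero]
  have hmod : k ^ (N.totient - 1) * k ≡ 1 [MOD N] := by
    rw [← pow_succ, Nat.sub_add_cancel (Nat.totient_pos.mpr hN)]
    exact Nat.ModEq.pow_totient hk
  have hper : (k ^ (N.totient - 1)) • (k • x) = x := by
    rw [← mul_smul]
    conv_rhs => rw [← one_nsmul x]
    exact nsmul_eq_nsmul_iff_modEq.mpr (hmod.of_dvd (addOrderOf_dvd_of_nsmul_eq_zero hx))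
  simpa only [hper] using gdft_nsmul_eq_zero a f hf hN hl hx' h0

lemma prod_sq_div_succ_pow {K : Type*} [Field K] (F : ℕ → K) (hF : ∀ k, F k ≠ 0) (n : ℕ) :
    ∏ k ∈ Finset.range n, (F k ^ 2 / F (k + 1)) ^ (2 ^ (n - 1 - k)) = F 0 ^ (2 ^ n) / F n := by
  induction n with
  | zero => simp [hF 0]
  | succ n ih =>
    have h : ∏ k ∈ Finset.range n, (F k ^ 2 / F (k + 1)) ^ (2 ^ (n + 1 - 1 - k)) =
        (∏ k ∈ Finset.range n, (F k ^ 2 / F (k + 1)) ^ (2 ^ (n - 1 - k))) ^ 2 := by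
      rw [← Finset.prod_pow]
      refine Finset.prod_congr rfl fun k hk => ?_
      rw [← pow_mul, ← pow_succ]
      have := Finset.mem_range.mp hk
      congr 2
      omega
    rw [Finset.prod_range_succ, h, ih, pow_succ 2 n, pow_mul]
    have := hF n
    have := hF (n + 1)
    simp only [add_tsub_cancel_right, tsub_self, pow_zero, pow_one]
    field_simp

theorem stmt5 {r : ℕ} (hr : 1 ≤ r) (a : Fin r → ℕ) [∀ i, NeZero (a i)]
    (f : (∀ i, ZMod (a i)) → ℂ) (hf : ∀ x, ∃ q : ℚ, f x = (q : ℂ))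
    (N : ℕ) (hN : N = AddMonoid.exponent (∀ i, ZMod (a i))) (hodd : Odd N)
    (x : ∀ i, ZMod (a i)) (hx : gdft a f x ≠ 0) :
    (∀ k : ℕ, gdft a f ((2 ^ k) • x) ≠ 0) ∧
      gdft a f x ^ (2 ^ N.totient - 1) =
        ∏ k ∈ Finset.range N.totient,
          (gdftAutocorr a f ![(2 ^ k) • x, (2 ^ k) • x] /
              gdftAutocorr a f ![(2 ^ (k + 1)) • x]) ^ (2 ^ (N.totient - 1 - k)) := by
  have hNpos : 0 < N := hodd.pos
  have hN0 : ∀ z : ∀ i, ZMod (a i), N • z = 0 := fun z => by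
    rw [hN]
    exact AddMonoid.exponent_nsmul_eq_zero z
  have h2 : Nat.Coprime 2 N := Nat.coprime_two_left.mpr hodd
  have hF : ∀ k : ℕ, gdft a f ((2 ^ k) • x) ≠ 0 := fun k =>
    gdft_nsmul_ne_zero a f hf hNpos (h2.pow_left k) (hN0 x) hx
  refine ⟨hF, ?_⟩
  have hneg : ∀ k : ℕ, gdft a f (-((2 ^ k) • x)) ≠ 0 := fun k => by
    have h (z : ∀ i, ZMod (a i)) : -z = (N - 1) • z := by
      rw [neg_eq_iff_add_eq_zero, ← succ_nsmul', Nat.sub_add_cancel hNpos, hN0]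
    rw [h]
    refine gdft_nsmul_ne_zero a f hf hNpos ?_ (hN0 _) (hF k)
    exact (Nat.coprime_self_sub_left hNpos).mpr (Nat.coprime_one_left N)
  have hterm : ∀ k : ℕ, gdftAutocorr a f ![(2 ^ k) • x, (2 ^ k) • x] /
      gdftAutocorr a f ![(2 ^ (k + 1)) • x] =
        gdft a f ((2 ^ k) • x) ^ 2 / gdft a f ((2 ^ (k + 1)) • x) := fun k => by
    have h : (2 ^ k) • x + (2 ^ k) • x = (2 ^ (k + 1)) • x := by
      rw [← add_nsmul, pow_succ, mul_two]
    simp only [gdftAutocorr, Fin.prod_univ_two, Fin.sum_univ_two, Fin.prod_univ_one,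
      Fin.sum_univ_one, Matrix.cons_val_zero, Matrix.cons_val_one, Matrix.cons_val_fin_one, h]
    rw [mul_div_mul_right _ _ (hneg (k + 1)), sq]
  have hper : (2 ^ N.totient) • x = x := by
    have h := (Nat.ModEq.pow_totient h2).symm
    obtain ⟨c, hc⟩ := (Nat.modEq_iff_dvd' Nat.one_le_two_pow).mp h
    rw [← Nat.sub_add_cancel (Nat.one_le_two_pow (n := N.totient)), hc, add_nsmul, mul_nsmul,
      hN0, smul_zero, zero_add, one_nsmul]
  simp only [hterm]
  rw [prod_sq_div_succ_pow (fun k => gdft a f ((2 ^ k) • x)) hF]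
  simp only [pow_zero, one_nsmul, hper]
  rw [eq_div_iff hx, ← pow_succ, Nat.sub_add_cancel Nat.one_le_two_pow]
end

section
/- Let N be a positive integer. If N is odd, then every element of ℤ/Nℤ is a sum of two units of the ring ℤ/Nℤ. If N is even, then every element of ℤ/Nℤ of the form 2·c (c ∈ ℤ/Nℤ) is a sum of two units of ℤ/Nℤ, and every element of ℤ/Nℤ not of the form 2·c is a sum of three units of ℤ/Nℤ. -/
theorem ZMod.isUnit_intCast_of_forall_prime_not_dvd {N : ℕ} {a : ℤ}
    (h : ∀ p : ℕ, p.Prime → p ∣ N → ¬ (p : ℤ) ∣ a) : IsUnit (a : ZMod N) := by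
  rw [ZMod.coe_int_isUnit_iff_isCoprime, Int.isCoprime_iff_gcd_eq_one]
  refine Nat.coprime_of_dvd fun p hp hpN hpa => h p hp ?_ (Int.natCast_dvd.2 hpa)
  simpa using hpN

/-- Take `t` to be the product of the primes dividing `N` but not `d`; then each prime factor of
`N` divides exactly one of `d` and `t`. -/
theorem Nat.exists_forall_prime_dvd_iff_not_dvd {N : ℕ} (hN : N ≠ 0) (d : ℕ) :
    ∃ t : ℕ, ∀ p : ℕ, p.Prime → p ∣ N → (p ∣ t ↔ ¬ p ∣ d) := by
  refine ⟨∏ q ∈ N.primeFactors with ¬ q ∣ d, q, fun p hp hpN => ?_⟩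
  rw [hp.prime.dvd_finsetProd_iff]
  constructor
  · rintro ⟨q, hq, hpq⟩
    obtain ⟨hqN, hqd⟩ := Finset.mem_filter.1 hq
    rwa [(Nat.prime_dvd_prime_iff_eq hp (Nat.prime_of_mem_primeFactors hqN)).1 hpq]
  · exact fun hpd =>
      ⟨p, Finset.mem_filter.2 ⟨Nat.mem_primeFactors.2 ⟨hp, hpN, hN⟩, hpd⟩, dvd_rfl⟩

theorem ZMod.exists_isUnit_add_eq_two_mul {N : ℕ} (hN : N ≠ 0) (d : ZMod N) :
    ∃ u v : ZMod N, IsUnit u ∧ IsUnit v ∧ 2 * d = u + v := by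
  have : NeZero N := ⟨hN⟩
  obtain ⟨t, ht⟩ := Nat.exists_forall_prime_dvd_iff_not_dvd hN d.val
  have hadd : IsUnit (((d.val : ℤ) + t : ℤ) : ZMod N) := by
    refine ZMod.isUnit_intCast_of_forall_prime_not_dvd fun p hp hpN h => ?_
    have hiff : (p : ℤ) ∣ d.val ↔ (p : ℤ) ∣ t :=
      ⟨fun hd => (dvd_add_right hd).1 h, fun hpt => (dvd_add_left hpt).1 h⟩
    rw [Int.natCast_dvd_natCast, Int.natCast_dvd_natCast, ht p hp hpN] at hiff
    tauto
  have hsub : IsUnit (((d.val : ℤ) - t : ℤ) : ZMod N) := by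
    refine ZMod.isUnit_intCast_of_forall_prime_not_dvd fun p hp hpN h => ?_
    have hiff : (p : ℤ) ∣ d.val ↔ (p : ℤ) ∣ t := dvd_iff_dvd_of_dvd_sub h
    rw [Int.natCast_dvd_natCast, Int.natCast_dvd_natCast, ht p hp hpN] at hiff
    tauto
  refine ⟨_, _, hadd, hsub, ?_⟩
  push_cast
  rw [ZMod.natCast_zmod_val]
  ring


theorem stmt6 (N : ℕ) (hN : 0 < N) :
    (Odd N → ∀ c : ZMod N, ∃ u v : ZMod N, IsUnit u ∧ IsUnit v ∧ c = u + v) ∧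
    (Even N →
      (∀ c : ZMod N, (∃ d : ZMod N, c = 2 * d) →
        ∃ u v : ZMod N, IsUnit u ∧ IsUnit v ∧ c = u + v) ∧
      (∀ c : ZMod N, ¬(∃ d : ZMod N, c = 2 * d) →
        ∃ u v w : ZMod N, IsUnit u ∧ IsUnit v ∧ IsUnit w ∧ c = u + v + w)) := by
  have hN' : N ≠ 0 := hN.ne'
  refine ⟨fun hodd c => ?_, fun _ => ⟨?_, fun c hc => ?_⟩⟩
  · have h2 : IsUnit ((2 : ℕ) : ZMod N) :=
      (ZMod.isUnit_iff_coprime 2 N).2 (Nat.coprime_two_left.2 hodd)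
    obtain ⟨d, rfl⟩ := h2.dvd (a := c)
    exact_mod_cast ZMod.exists_isUnit_add_eq_two_mul hN' d
  · rintro _ ⟨d, rfl⟩
    exact ZMod.exists_isUnit_add_eq_two_mul hN' d
  · have : NeZero N := ⟨hN'⟩
    obtain ⟨k, hk | hk⟩ := Nat.even_or_odd' c.val
    · refine absurd ⟨(k : ZMod N), ?_⟩ hc
      rw [← ZMod.natCast_zmod_val c, hk]
      push_cast
      rfl
    · obtain ⟨u, v, hu, hv, huv⟩ := ZMod.exists_isUnit_add_eq_two_mul hN' (k : ZMod N)
      refine ⟨u, v, 1, hu, hv, isUnit_one, ?_⟩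
      rw [← huv, ← ZMod.natCast_zmod_val c, hk]
      push_cast
      rfl
end

section
/- Let N = exp(G), ζ = exp(2πi/N), K = ℚ(ζ) ⊆ ℂ, and let f : G → ℂ be rational-valued. Let t ≥ 1, let x_1, …, x_t ∈ G with f̂(x_j) ≠ 0 for each j, let β_1, …, β_t be nonzero elements of K with β_j^N = f̂(x_j)^N, and let c_1, …, c_t be integers. For each j let u_j, v_j, w_j be integers with c_j ≡ u_j + v_j + w_j (mod N), where u_j and v_j are coprime to N and w_j is either 0 or coprime to N. Then ∏_{j=1}^t ( f̂(x_j)/β_j )^{c_j} = ∏_{j=1}^t [ ( f̂(u_j·x_j)·f̂(v_j·x_j) ) / ( σ_{u_j}(β_j)·σ_{v_j}(β_j) ) · ( f̂(w_j·x_j)/σ_{w_j}(β_j) if w_j ≠ 0, and 1 if w_j = 0 ) ]. -/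
open Complex Finset

/-- Every modulus divides the exponent of the product group. -/
lemma dvd_exponent_pi_zmod {ι : Type*} [DecidableEq ι] (a : ι → ℕ) (i : ι) :
    a i ∣ AddMonoid.exponent (∀ i, ZMod (a i)) := by
  have h := congrFun (AddMonoid.exponent_nsmul_eq_zero
    (Pi.single i (1 : ZMod (a i)) : ∀ i, ZMod (a i))) i
  rw [← ZMod.natCast_eq_zero_iff]
  simpa using h

/-- The Fourier transform expressed through integer powers of `exp(2πi/N)`. -/
lemma gdft_eq_sum_zpow {r : ℕ} (a : Fin r → ℕ) [∀ i, NeZero (a i)]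
    (f : (∀ i, ZMod (a i)) → ℂ) {N : ℕ} (hN0 : N ≠ 0) (d : Fin r → ℕ)
    (hd : ∀ i, N = a i * d i) (x : ∀ i, ZMod (a i)) :
    gdft a f x = ∑ y, f y * Complex.exp (2 * Real.pi * Complex.I / N) ^
      (-∑ i, ((x i).val : ℤ) * ((y i).val : ℤ) * (d i : ℤ)) := by
  unfold gdft
  refine Finset.sum_congr rfl fun y _ => ?_
  rw [← Complex.exp_int_mul]
  congr 2
  have hN : (N : ℂ) ≠ 0 := by exact_mod_cast hN0
  push_cast
  rw [neg_mul, neg_inj, Finset.mul_sum, Finset.sum_mul]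
  refine Finset.sum_congr rfl fun i _ => ?_
  have ha : (a i : ℂ) ≠ 0 := by exact_mod_cast NeZero.ne (a i)
  have h : (N : ℂ) = a i * d i := by exact_mod_cast hd i
  field_simp
  rw [h]
  ring

/-- The pairing exponent is linear in the first variable modulo `N`. -/
lemma pairing_zsmul_modEq {r : ℕ} (a : Fin r → ℕ) [∀ i, NeZero (a i)]
    {N : ℕ} (d : Fin r → ℕ) (hd : ∀ i, N = a i * d i) (b : ℤ)
    (x y : ∀ i, ZMod (a i)) :
    ∑ i, (((b • x) i).val : ℤ) * ((y i).val : ℤ) * (d i : ℤ) ≡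
      b * ∑ i, ((x i).val : ℤ) * ((y i).val : ℤ) * (d i : ℤ) [ZMOD (N : ℤ)] := by
  rw [Int.modEq_iff_dvd, Finset.mul_sum, ← Finset.sum_sub_distrib]
  refine Finset.dvd_sum fun i _ => ?_
  have h : (a i : ℤ) ∣ b * (x i).val - ((b • x) i).val := by
    rw [← ZMod.intCast_zmod_eq_zero_iff_dvd]
    simp
  obtain ⟨k, hk⟩ := h
  refine ⟨k * (y i).val, ?_⟩
  rw [hd i]
  push_cast
  linear_combination ((y i).val : ℤ) * (d i : ℤ) * hk

/-- Integer powers of an `N`-th root of unity depend only on the exponent modulo `N`. -/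
lemma zpow_eq_zpow_of_modEq {M : Type*} [GroupWithZero M] {z : M} (hz : z ≠ 0) {N : ℕ}
    (h1 : z ^ N = 1) {m n : ℤ} (h : m ≡ n [ZMOD (N : ℤ)]) : z ^ m = z ^ n := by
  obtain ⟨k, hk⟩ := h.dvd
  rw [show n = m + N * k by omega, zpow_add₀ hz, zpow_mul, zpow_natCast, h1, one_zpow, mul_one]

/-- A field automorphism raising a root of unity `ζ` to the power `b` maps the Fourier transform
at `x` of a rational-valued function to the one at `b • x`. -/
lemma exists_gdft_galois {r : ℕ} (a : Fin r → ℕ) [∀ i, NeZero (a i)]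
    (f : (∀ i, ZMod (a i)) → ℂ) (hf : ∀ x, ∃ q : ℚ, f x = (q : ℂ))
    {N : ℕ} (hN0 : N ≠ 0) (d : Fin r → ℕ) (hd : ∀ i, N = a i * d i)
    {ζ : ℂ} (hζ : ζ = Complex.exp (2 * Real.pi * Complex.I / N))
    (K : IntermediateField ℚ ℂ) (hζK : ζ ∈ K) (x : ∀ i, ZMod (a i)) :
    ∃ F : K, (F : ℂ) = gdft a f x ∧ ∀ (b : ℤ) (s : K ≃+* K),
      ((s ⟨ζ, hζK⟩ : K) : ℂ) = ζ ^ b → ((s F : K) : ℂ) = gdft a f (b • x) := by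
  choose q hq using hf
  have hζ0 : ζ ≠ 0 := hζ ▸ Complex.exp_ne_zero _
  have hζ1 : ζ ^ N = 1 := by
    rw [hζ]
    exact (Complex.isPrimitiveRoot_exp N hN0).pow_eq_one
  have hcoe : ∀ (z : K) (n : ℤ), ((z ^ n : K) : ℂ) = (z : ℂ) ^ n := map_zpow₀ (algebraMap K ℂ)
  refine ⟨∑ y, (q y : K) * (⟨ζ, hζK⟩ : K) ^
    (-∑ i, ((x i).val : ℤ) * ((y i).val : ℤ) * (d i : ℤ)), ?_, fun b s hs => ?_⟩
  · rw [gdft_eq_sum_zpow a f hN0 d hd, ← hζ]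
    push_cast
    refine Finset.sum_congr rfl fun y _ => ?_
    rw [hcoe, hq]
  · rw [gdft_eq_sum_zpow a f hN0 d hd, ← hζ, map_sum]
    push_cast
    refine Finset.sum_congr rfl fun y _ => ?_
    rw [map_mul, map_ratCast, map_zpow₀, hq]
    push_cast
    rw [hcoe, hs, ← zpow_mul, mul_neg]
    congr 1
    exact zpow_eq_zpow_of_modEq hζ0 hζ1 (pairing_zsmul_modEq a d hd b x y).symm.neg

theorem stmt9 {r : ℕ} (hr : 1 ≤ r) (a : Fin r → ℕ) [∀ i, NeZero (a i)]
    (f : (∀ i, ZMod (a i)) → ℂ) (hf : ∀ x, ∃ q : ℚ, f x = (q : ℂ))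
    (N : ℕ) (hN : N = AddMonoid.exponent (∀ i, ZMod (a i)))
    (ζ : ℂ) (hζ : ζ = Complex.exp (2 * Real.pi * Complex.I / N))
    (K : IntermediateField ℚ ℂ) (hK : K = IntermediateField.adjoin ℚ {ζ})
    (hζK : ζ ∈ K)
    (σ : ℤ → (K ≃+* K))
    (hσ : ∀ b : ℤ, IsCoprime b (N : ℤ) → ((σ b ⟨ζ, hζK⟩ : K) : ℂ) = ζ ^ b)
    (t : ℕ) (ht : 1 ≤ t) (x : Fin t → ∀ i, ZMod (a i))
    (hx : ∀ j, gdft a f (x j) ≠ 0)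
    (β : Fin t → K) (hβ0 : ∀ j, (β j : ℂ) ≠ 0)
    (hβ : ∀ j, (β j : ℂ) ^ N = gdft a f (x j) ^ N)
    (c u v w : Fin t → ℤ)
    (hcuvw : ∀ j, c j ≡ u j + v j + w j [ZMOD (N : ℤ)])
    (hu : ∀ j, IsCoprime (u j) (N : ℤ))
    (hv : ∀ j, IsCoprime (v j) (N : ℤ))
    (hw : ∀ j, w j = 0 ∨ IsCoprime (w j) (N : ℤ)) :
    ∏ j, (gdft a f (x j) / (β j : ℂ)) ^ (c j) =
      ∏ j,
        ((gdft a f ((u j) • x j) * gdft a f ((v j) • x j)) /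
            (((σ (u j) (β j) : K) : ℂ) * ((σ (v j) (β j) : K) : ℂ))) *
          (if w j = 0 then 1
            else gdft a f ((w j) • x j) / ((σ (w j) (β j) : K) : ℂ)) := by
  have hN0 : N ≠ 0 := hN ▸ AddMonoid.exponent_ne_zero_of_finite
  choose d hd using fun i => hN ▸ dvd_exponent_pi_zmod a i
  have hprim : IsPrimitiveRoot ζ N := hζ ▸ Complex.isPrimitiveRoot_exp N hN0
  refine Finset.prod_congr rfl fun j _ => ?_
  obtain ⟨F, hF, hFσ⟩ := exists_gdft_galois a f hf hN0 d hd hζ K hζK (x j)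
  have hβj := hβ0 j
  set q : K := F / β j with hq
  have hqC : (q : ℂ) = gdft a f (x j) / (β j : ℂ) := by rw [← hF]; simp [hq]
  have hq0 : (q : ℂ) ≠ 0 := hqC ▸ div_ne_zero (hx j) hβj
  have hq1 : (q : ℂ) ^ N = 1 := by
    rw [hqC, div_pow, hβ j, div_self (pow_ne_zero _ (hx j))]
  have key : ∀ b : ℤ, IsCoprime b (N : ℤ) →
      gdft a f (b • x j) / ((σ b (β j) : K) : ℂ) = (q : ℂ) ^ b := by
    intro b hb
    have : NeZero N := ⟨hN0⟩
    obtain ⟨k, -, hk⟩ := hprim.eq_pow_of_pow_eq_one hq1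
    have hqk : q = (⟨ζ, hζK⟩ : K) ^ k := Subtype.ext (by simpa using hk.symm)
    have h1 : ((σ b q : K) : ℂ) = gdft a f (b • x j) / ((σ b (β j) : K) : ℂ) := by
      rw [← hFσ b (σ b) (hσ b hb), hq, map_div₀]
      simp
    rw [← h1, hqk, map_pow]
    push_cast
    rw [hσ b hb, ← zpow_natCast, ← zpow_natCast, ← zpow_mul, ← zpow_mul, mul_comm]
  rw [← hqC, zpow_eq_zpow_of_modEq hq0 hq1 (hcuvw j), zpow_add₀ hq0, zpow_add₀ hq0,
    mul_div_mul_comm, key _ (hu j), key _ (hv j)]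
  congr 1
  split_ifs with h
  · rw [h, zpow_zero]
  · rw [key _ ((hw j).resolve_left h)]
end

section
/- Assume the invariant factor form: each a_i ≥ 2 and a_i divides a_{i+1} for all i < r−1. If f, g : G → ℂ are rational-valued and have the same autocorrelations up to order 3r+3, then g is a translation of f, i.e. there exists y ∈ G with g(x) = f(x+y) for all x ∈ G. -/
open Complex Finset

/-- For even `x` one can write `x` as a sum of two integers prime to `N`. -/
lemma exists_isCoprime_and_isCoprime_sub (N : ℕ) (hN : N ≠ 0) {x : ℤ} (hx : Even x) :
    ∃ u : ℤ, IsCoprime u N ∧ IsCoprime (x - u) N := by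
  induction N using Nat.recOnPrimeCoprime with
  | zero => exact absurd rfl hN
  | prime_pow p n hp =>
    have key : ∀ u : ℤ, ¬ (p : ℤ) ∣ u → IsCoprime u ((p ^ n : ℕ) : ℤ) := fun u hu => by
      push_cast
      exact (((Nat.prime_iff_prime_int.1 hp).coprime_iff_not_dvd.2 hu).symm).pow_right
    by_cases h : (p : ℤ) ∣ x - 1
    · refine ⟨-1, isCoprime_one_left.neg_left, key _ fun h' => ?_⟩
      have h2 : (p : ℤ) ∣ 2 := by
        have := dvd_sub h' h
        ring_nf at this
        exact this
      have hp2 : p = 2 := (Nat.prime_dvd_prime_iff_eq hp Nat.prime_two).1 (by exact_mod_cast h2)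
      subst hp2
      obtain ⟨k, rfl⟩ := hx
      push_cast at h
      omega
    · exact ⟨1, isCoprime_one_left, key _ h⟩
  | coprime a b ha hb hab iha ihb =>
    obtain ⟨u, hu, hu'⟩ := iha (by omega)
    obtain ⟨v, hv, hv'⟩ := ihb (by omega)
    obtain ⟨s, t, hst⟩ := Nat.isCoprime_iff_coprime.2 hab
    have e1 : v * (s * a) + u * (t * b) = u + a * (s * (v - u)) := by
      linear_combination u * hst
    have e2 : v * (s * a) + u * (t * b) = v + b * (t * (u - v)) := by
      linear_combination v * hst
    refine ⟨v * (s * a) + u * (t * b), ?_, ?_⟩ <;> push_cast <;>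
      refine IsCoprime.mul_right ?_ ?_
    · rw [e1]; exact hu.add_mul_left_left _
    · rw [e2]; exact hv.add_mul_left_left _
    · rw [e1, ← sub_sub, sub_eq_add_neg, ← mul_neg]; exact hu'.add_mul_left_left _
    · rw [e2, ← sub_sub, sub_eq_add_neg, ← mul_neg]; exact hv'.add_mul_left_left _

/-- Modulo `N`, a sum of four units is a sum of two units. -/
lemma exists_two_coprime_of_four (N : ℕ) (hN : N ≠ 0) {u₁ u₂ u₃ u₄ : ℤ}
    (h₁ : IsCoprime u₁ N) (h₂ : IsCoprime u₂ N) (h₃ : IsCoprime u₃ N) (h₄ : IsCoprime u₄ N) :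
    ∃ v w : ℤ, IsCoprime v N ∧ IsCoprime w N ∧ (N : ℤ) ∣ u₁ + u₂ + u₃ + u₄ - (v + w) := by
  obtain ⟨x, hx, hxN⟩ : ∃ x : ℤ, Even x ∧ (N : ℤ) ∣ u₁ + u₂ + u₃ + u₄ - x := by
    rcases Int.even_or_odd (u₁ + u₂ + u₃ + u₄) with h | h
    · exact ⟨_, h, by simp⟩
    · rcases Nat.even_or_odd N with hN' | hN'
      · have key : ∀ u : ℤ, IsCoprime u N → Odd u := fun u hu => by
          rw [← Int.not_even_iff_odd]
          intro he
          have := hu.isUnit_of_dvd' he.two_dvd (by exact_mod_cast hN'.two_dvd)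
          norm_num [Int.isUnit_iff] at this
        have := (((key _ h₁).add_odd (key _ h₂)).add_odd (key _ h₃)).add_odd (key _ h₄)
        exact absurd this (Int.not_even_iff_odd.2 h)
      · exact ⟨u₁ + u₂ + u₃ + u₄ + N, h.add_odd (by exact_mod_cast hN'), by simp⟩
  obtain ⟨u, hu, hu'⟩ := exists_isCoprime_and_isCoprime_sub N hN hx
  exact ⟨u, x - u, hu, hu', by simpa using hxN⟩

lemma ZMod.exists_zsmul_eq_of_addOrderOf_dvd {n : ℕ} [NeZero n] {x y : ZMod n}
    (h : addOrderOf x ∣ addOrderOf y) : ∃ c : ℤ, x = c • y := by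
  have hn : 0 < n := NeZero.pos n
  obtain ⟨d, hd⟩ : ∃ d, d = n.gcd y.val := ⟨_, rfl⟩
  have hdn : d ∣ n := hd ▸ Nat.gcd_dvd_left _ _
  have hy : addOrderOf y = n / d := by
    rw [hd, ← ZMod.addOrderOf_coe y.val hn.ne', ZMod.natCast_zmod_val]
  have hx : d ∣ x.val := by
    have h1 : ((n / d * x.val : ℕ) : ZMod n) = 0 := by
      have := addOrderOf_dvd_iff_nsmul_eq_zero.1 (hy ▸ h)
      simpa [nsmul_eq_mul] using this
    rw [ZMod.natCast_eq_zero_iff] at h1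
    obtain ⟨e, he⟩ := hdn
    have hd0 : 0 < d := Nat.pos_of_ne_zero (by rintro rfl; simp at he; omega)
    have he0 : 0 < e := Nat.pos_of_ne_zero (by rintro rfl; simp at he; omega)
    rw [Nat.div_eq_of_eq_mul_right hd0 he] at h1
    exact Nat.dvd_of_mul_dvd_mul_left he0 (by rwa [mul_comm e d, ← he])
  obtain ⟨e, he⟩ := hx
  have hb := Nat.gcd_eq_gcd_ab n y.val
  refine ⟨Nat.gcdB n y.val * e, ?_⟩
  have : (x.val : ℤ) = n * (Nat.gcdA n y.val * e) + (Nat.gcdB n y.val * e) * y.val := by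
    rw [he, hd]; push_cast; rw [hb]; ring
  have h2 := congrArg (Int.cast : ℤ → ZMod n) this
  simpa [zsmul_eq_mul] using h2

/-- A family of `p`-power torsion elements of `∏ i, ZMod (a i)` supported on the coordinates in `I`
is generated by at most `#I` of its members. -/
lemma exists_finset_card_le_mem_closure {ι : Type*} [DecidableEq ι] {a : ι → ℕ}
    [∀ i, NeZero (a i)] {S : Type*} [Finite S] {p k : ℕ} (hp : p.Prime) (I : Finset ι) :
    ∀ v : S → ∀ i, ZMod (a i), (∀ s, p ^ k • v s = 0) → (∀ s, ∀ i ∉ I, v s i = 0) →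
      ∃ T : Finset S, T.card ≤ I.card ∧ ∀ s, v s ∈ AddSubgroup.closure (v '' T) := by
  classical
  induction I using Finset.induction_on with
  | empty =>
    intro v _ hv
    refine ⟨∅, le_rfl, fun s => ?_⟩
    rw [show v s = 0 from funext fun i => hv s i (by simp)]
    exact zero_mem _
  | insert j I hj ih =>
    intro v hvp hv
    rcases isEmpty_or_nonempty S with hS | hS
    · exact ⟨∅, by simp, fun s => hS.elim s⟩
    obtain ⟨s₀, hs₀⟩ := Finite.exists_max fun s => addOrderOf (v s j)
    have hord : ∀ s, addOrderOf (v s j) ∣ addOrderOf (v s₀ j) := fun s => by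
      have h : ∀ s, ∃ m ≤ k, addOrderOf (v s j) = p ^ m := fun s =>
        (Nat.dvd_prime_pow hp).1 <| addOrderOf_dvd_iff_nsmul_eq_zero.2 (congrFun (hvp s) j)
      obtain ⟨m, -, hm⟩ := h s
      obtain ⟨m₀, -, hm₀⟩ := h s₀
      have := hs₀ s
      simp only [hm, hm₀] at this ⊢
      exact pow_dvd_pow _ ((Nat.pow_le_pow_iff_right hp.one_lt).1 this)
    choose c hc using fun s => ZMod.exists_zsmul_eq_of_addOrderOf_dvd (hord s)
    obtain ⟨T, hT, hvT⟩ := ih (fun s => v s - c s • v s₀)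
      (fun s => by rw [smul_sub, smul_comm, hvp, hvp, smul_zero, sub_zero]) (fun s i hi => by
        rcases eq_or_ne i j with rfl | hij
        · simpa [sub_eq_zero] using hc s
        · simp [hv s i (by simp [hij, hi]), hv s₀ i (by simp [hij, hi])])
    have h₀ : v s₀ ∈ AddSubgroup.closure (v '' (insert s₀ T : Finset S)) :=
      AddSubgroup.subset_closure ⟨s₀, by simp, rfl⟩
    refine ⟨insert s₀ T, (Finset.card_insert_le _ _).trans ?_, fun s => ?_⟩
    · rw [Finset.card_insert_of_notMem hj]; omega
    rw [← sub_add_cancel (v s) (c s • v s₀)]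
    refine add_mem ((AddSubgroup.closure_le _).2 ?_ (hvT s)) (zsmul_mem h₀ _)
    rintro _ ⟨t, ht, rfl⟩
    exact sub_mem (AddSubgroup.subset_closure ⟨t, by simp [Finset.mem_coe.1 ht], rfl⟩)
      (zsmul_mem h₀ _)

section ShortRelations

variable {G M : Type*} [AddCommGroup G] [AddCommGroup M]

/-- The sums of at most `n` points of the graph of `h` over `S`. -/
def shortSums (S : Set G) (h : G → M) (n : ℕ) : Set (G × M) :=
  {γ | ∃ L : List G, (∀ x ∈ L, x ∈ S) ∧ L.length ≤ n ∧ γ = (L.sum, (L.map h).sum)}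

/-- The group generated by the points of the graph of `h` over the multiples of `s` by integers
prime to `N`. -/
def orbitGraph (N : ℕ) (h : G → M) (s : G) : AddSubgroup (G × M) :=
  AddSubgroup.closure {γ | ∃ u : ℤ, IsCoprime u N ∧ γ = (u • s, h (u • s))}

lemma mk_mem_orbitGraph (N : ℕ) (h : G → M) (s : G) : (s, h s) ∈ orbitGraph N h s :=
  AddSubgroup.subset_closure ⟨1, isCoprime_one_left, by simp⟩

variable {S : Set G} {h : G → M}

lemma add_mem_shortSums {m n : ℕ} {γ δ : G × M} (hγ : γ ∈ shortSums S h m)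
    (hδ : δ ∈ shortSums S h n) : γ + δ ∈ shortSums S h (m + n) := by
  obtain ⟨L, hL, hm, rfl⟩ := hγ
  obtain ⟨K, hK, hn, rfl⟩ := hδ
  refine ⟨L ++ K, fun x hx => (List.mem_append.1 hx).elim (hL x) (hK x), ?_, by simp⟩
  simp only [List.length_append]
  omega

/-- Every relation of length at most `n` between elements of `S` is satisfied by `h`. -/
def RespectsRelations (S : Set G) (h : G → M) (n : ℕ) : Prop :=
  ∀ L : List G, (∀ x ∈ L, x ∈ S) → L.length ≤ n → L.sum = 0 → (L.map h).sum = 0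

namespace RespectsRelations

variable {n N : ℕ}

lemma map_neg (H : RespectsRelations S h n) (hn : 2 ≤ n) {x : G} (hx : x ∈ S) (hx' : -x ∈ S) :
    h (-x) = -h x := by
  have := H [x, -x] (by simp [hx, hx']) (by simpa using hn) (by simp)
  rw [eq_neg_iff_add_eq_zero, add_comm]
  simpa using this

lemma eq_zero_of_mem_shortSums (H : RespectsRelations S h n) {γ : G × M}
    (hγ : γ ∈ shortSums S h n) (h0 : γ.1 = 0) : γ = 0 := by
  obtain ⟨L, hL, hm, rfl⟩ := hγ
  exact Prod.ext h0 (H L hL hm h0)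

/-- Every element of an orbit graph is a sum of at most three of the generators. -/
lemma orbitGraph_subset (H : RespectsRelations S h n) (hn : 6 ≤ n) (hN : N ≠ 0)
    (hNG : ∀ x : G, N • x = 0)
    (hS : ∀ s ∈ S, ∀ u : ℤ, IsCoprime u N → u • s ∈ S) {s : G} (hs : s ∈ S) :
    (orbitGraph N h s : Set (G × M)) ⊆ shortSums S h 3 := by
  have hneg : ∀ u : ℤ, IsCoprime u N → h (-u • s) = -h (u • s) := fun u hu => by
    have hu' := hS s hs _ hu.neg_left
    rw [neg_smul] at hu' ⊢
    exact H.map_neg (by omega) (hS s hs u hu) hu'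
  have key : ∀ γ ∈ orbitGraph N h s,
      (∃ u v : ℤ, IsCoprime u N ∧ IsCoprime v N ∧
        γ = (u • s + v • s, h (u • s) + h (v • s))) ∨
      (∃ u v w : ℤ, IsCoprime u N ∧ IsCoprime v N ∧ IsCoprime w N ∧
        γ = (u • s + v • s + w • s, h (u • s) + h (v • s) + h (w • s))) := by
    intro γ hγ
    unfold orbitGraph at hγ
    rw [← AddSubgroup.mem_toAddSubmonoid, AddSubgroup.closure_toAddSubmonoid] at hγ
    induction hγ using AddSubmonoid.closure_induction_right with
    | zero =>
      refine .inl ⟨1, -1, isCoprime_one_left, isCoprime_one_left.neg_left, ?_⟩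
      rw [hneg 1 isCoprime_one_left]
      simp [Prod.zero_eq_mk]
    | add_right γ _ δ hδ ih =>
      obtain ⟨w, hw, rfl⟩ : ∃ w : ℤ, IsCoprime w N ∧ δ = (w • s, h (w • s)) := by
        rcases hδ with hδ | ⟨u, hu, hδ⟩
        · exact hδ
        · refine ⟨-u, hu.neg_left, ?_⟩
          rw [hneg u hu, neg_smul, ← neg_neg δ, hδ, Prod.neg_mk]
      rcases ih with ⟨u, v, hu, hv, rfl⟩ | ⟨u, v, x, hu, hv, hx, rfl⟩
      · exact .inr ⟨u, v, w, hu, hv, hw, by simp⟩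
      · obtain ⟨y, z, hy, hz, k, hk⟩ := exists_two_coprime_of_four N hN hu hv hx hw
        have hsum : u • s + v • s + x • s + w • s = y • s + z • s := by
          simp only [← add_smul]
          rw [sub_eq_iff_eq_add.1 hk, add_smul, mul_comm, mul_smul, natCast_zsmul, hNG]
          simp
        have hrel := H [u • s, v • s, x • s, w • s, -y • s, -z • s]
          (by simpa using ⟨hS s hs u hu, hS s hs v hv, hS s hs x hx, hS s hs w hw,
            by simpa using hS s hs _ hy.neg_left, by simpa using hS s hs _ hz.neg_left⟩)
          (by simpa using hn) (by
            have : u • s + v • s + x • s + w • s - (y • s + z • s) = 0 := sub_eq_zero.2 hsum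
            rw [← this]
            simp only [List.sum_cons, List.sum_nil, neg_smul]
            abel)
        refine .inl ⟨y, z, hy, hz, ?_⟩
        refine Prod.ext hsum ?_
        simp only [List.map_cons, List.map_nil, List.sum_cons, List.sum_nil, hneg y hy,
          hneg z hz] at hrel
        rw [← sub_eq_zero, ← hrel]
        simp only [Prod.snd_add]
        abel
  intro γ hγ
  rcases key γ hγ with ⟨u, v, hu, hv, rfl⟩ | ⟨u, v, w, hu, hv, hw, rfl⟩
  · exact ⟨[u • s, v • s], by simp [hS s hs u hu, hS s hs v hv], by simp, by simp⟩
  · exact ⟨[u • s, v • s, w • s], by simp [hS s hs u hu, hS s hs v hv, hS s hs w hw], by simp,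
      by simp [add_assoc]⟩

lemma iSup_orbitGraph_subset (H : RespectsRelations S h n) (hn : 6 ≤ n) (hN : N ≠ 0)
    (hNG : ∀ x : G, N • x = 0)
    (hS : ∀ s ∈ S, ∀ u : ℤ, IsCoprime u N → u • s ∈ S) (T : Finset S) :
    ((⨆ t ∈ T, orbitGraph N h (t : G) : AddSubgroup (G × M)) : Set (G × M)) ⊆
      shortSums S h (3 * T.card) := by
  classical
  induction T using Finset.induction_on with
  | empty =>
    intro γ hγ
    have : γ = 0 := by simpa using hγ
    exact ⟨[], by simp, by simp, by simp [this, Prod.zero_eq_mk]⟩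
  | insert t T ht ih =>
    intro γ hγ
    rw [Finset.iSup_insert, SetLike.mem_coe, AddSubgroup.mem_sup] at hγ
    obtain ⟨α, hα, β, hβ, rfl⟩ := hγ
    rw [Finset.card_insert_of_notMem ht, mul_add, mul_one, add_comm (3 * _)]
    exact add_mem_shortSums (H.orbitGraph_subset hn hN hNG hS t.2 hα) (ih hβ)

end RespectsRelations

end ShortRelations

/-- In a group with `r ≥ 1` cyclic factors, on a set stable under multiplication by units, all
relations follow from those of length at most `3 * r + 3`. -/
theorem RespectsRelations.snd_eq_zero {ι M : Type*} [Fintype ι] [Nonempty ι] [AddCommGroup M]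
    {a : ι → ℕ} [∀ i, NeZero (a i)] {S : Set (∀ i, ZMod (a i))} {h : (∀ i, ZMod (a i)) → M}
    (H : RespectsRelations S h (3 * Fintype.card ι + 3)) {N : ℕ} (hN : N ≠ 0)
    (hNG : ∀ x : ∀ i, ZMod (a i), N • x = 0)
    (hS : ∀ s ∈ S, ∀ u : ℤ, IsCoprime u N → u • s ∈ S) {γ : (∀ i, ZMod (a i)) × M}
    (hγ : γ ∈ AddSubgroup.closure ((fun s => (s, h s)) '' S)) (h0 : γ.1 = 0) : γ.2 = 0 := by
  classical
  have hι : 1 ≤ Fintype.card ι := Fintype.card_pos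
  have hn : 6 ≤ 3 * Fintype.card ι + 3 := by omega
  rw [← AddMonoid.addOrderOf_eq_one_iff]
  refine Nat.eq_one_iff_not_exists_prime_dvd.2 fun p hp hpd => ?_
  obtain ⟨k, m, hpm, hkm⟩ := Nat.exists_eq_pow_mul_and_not_dvd hN p hp.ne_one
  refine hpm (hpd.trans (addOrderOf_dvd_iff_nsmul_eq_zero.2 ?_))
  obtain ⟨T, hT, hspan⟩ := exists_finset_card_le_mem_closure (k := k) hp Finset.univ
    (fun s : S => m • (s : ∀ i, ZMod (a i))) (fun s => by rw [← mul_smul, ← hkm, hNG])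
    (by simp)
  have hsub := H.iSup_orbitGraph_subset hn hN hNG hS T
  have hmem : ∀ t ∈ T, orbitGraph N h (t : ∀ i, ZMod (a i)) ≤
      ⨆ t ∈ T, orbitGraph N h (t : ∀ i, ZMod (a i)) := fun t ht =>
    le_iSup₂_of_le t ht le_rfl
  -- the multiples of the generators by `m` all lie in the sum of the chosen orbit graphs
  have hgen : AddSubgroup.closure ((fun s => (s, h s)) '' S) ≤
      (⨆ t ∈ T, orbitGraph N h (t : ∀ i, ZMod (a i))).comap
        (nsmulAddMonoidHom (α := (∀ i, ZMod (a i)) × M) m) := by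
    rw [AddSubgroup.closure_le]
    rintro _ ⟨s, hs, rfl⟩
    let Λ := AddSubgroup.closure
      ((fun t : S => m • ((t : ∀ i, ZMod (a i)), h t)) '' (T : Set S))
    have hΛ : Λ ≤ ⨆ t ∈ T, orbitGraph N h (t : ∀ i, ZMod (a i)) := by
      rw [AddSubgroup.closure_le]
      rintro _ ⟨t, ht, rfl⟩
      exact nsmul_mem (hmem t ht (mk_mem_orbitGraph N h _)) m
    obtain ⟨lam, hlam, hfst⟩ : ∃ lam ∈ Λ, lam.1 = m • s := by
      have : m • s ∈ Λ.map (AddMonoidHom.fst _ M) := by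
        rw [AddMonoidHom.map_closure, ← Set.image_comp]
        exact hspan ⟨s, hs⟩
      simpa using this
    have hdiff : m • (s, h s) - lam = 0 := by
      refine H.eq_zero_of_mem_shortSums (γ := m • (s, h s) - lam) ?_ (by simp [hfst])
      have h1 := H.orbitGraph_subset hn hN hNG hS hs (nsmul_mem (mk_mem_orbitGraph N h s) m)
      obtain ⟨L, hL, hLc, hLe⟩ := add_mem_shortSums h1 (hsub (neg_mem (hΛ hlam)))
      refine ⟨L, hL, hLc.trans ?_, by rw [sub_eq_add_neg, hLe]⟩
      rw [Finset.card_univ] at hT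
      omega
    change m • (s, h s) ∈ ⨆ t ∈ T, orbitGraph N h (t : ∀ i, ZMod (a i))
    rw [sub_eq_zero.1 hdiff]
    exact hΛ hlam
  have hmγ : m • γ = 0 := by
    refine H.eq_zero_of_mem_shortSums ?_ (by simp [h0])
    obtain ⟨L, hL, hLc, hLe⟩ := hsub (hgen hγ)
    refine ⟨L, hL, hLc.trans ?_, hLe⟩
    rw [Finset.card_univ] at hT
    omega
  exact congrArg Prod.snd hmγ

section Fourier

variable {ι : Type*} [Fintype ι] {a : ι → ℕ} [∀ i, NeZero (a i)]

/-- The standard bicharacter of `∏ i, ZMod (a i)`, as a family of additive characters. -/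
noncomputable def pairing (x : ∀ i, ZMod (a i)) : AddChar (∀ i, ZMod (a i)) ℂ where
  toFun y := ∏ i, ZMod.stdAddChar (x i * y i)
  map_zero_eq_one' := by simp
  map_add_eq_mul' y z := by simp [mul_add, AddChar.map_add_eq_mul, Finset.prod_mul_distrib]

lemma pairing_comm (x y : ∀ i, ZMod (a i)) : pairing x y = pairing y x := by
  simp [pairing, mul_comm]

lemma pairing_ne_zero (x y : ∀ i, ZMod (a i)) : pairing x y ≠ 0 :=
  ((pairing x).val_isUnit y).ne_zero

lemma pairing_add_left (x y z : ∀ i, ZMod (a i)) :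
    pairing (x + y) z = pairing x z * pairing y z := by
  simp_rw [pairing_comm _ z, AddChar.map_add_eq_mul]

lemma pairing_neg_sum {m : ℕ} (x : Fin m → ∀ i, ZMod (a i)) (y : ∀ i, ZMod (a i)) :
    pairing (-∑ j, x j) y * ∏ j, pairing (x j) y = 1 := by
  simp_rw [pairing_comm _ y]
  have : ∏ j, pairing y (x j) = pairing y (∑ j, x j) :=
    (map_prod (pairing y).toMonoidHom (fun j => Multiplicative.ofAdd (x j)) Finset.univ).symm
  rw [this, ← AddChar.map_add_eq_mul]
  simp

lemma pairing_ne_zero_of_ne_zero {x : ∀ i, ZMod (a i)} (hx : x ≠ 0) : pairing x ≠ 0 := by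
  classical
  obtain ⟨i, hi⟩ := Function.ne_iff.1 hx
  rw [AddChar.ne_zero_iff]
  refine ⟨Pi.single i 1, ?_⟩
  have : pairing x (Pi.single i 1) = ZMod.stdAddChar (x i) := by
    change ∏ j, ZMod.stdAddChar (x j * (Pi.single i (1 : ZMod (a i)) : ∀ j, ZMod (a j)) j) = _
    rw [Finset.prod_eq_single i]
    · simp
    · intro j _ hj
      simp [hj]
    · simp
  rw [this, ← AddChar.map_zero_eq_one (ZMod.stdAddChar (N := a i))]
  exact fun h => hi (ZMod.injective_stdAddChar h)

lemma pairing_injective :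
    Function.Injective (pairing : (∀ i, ZMod (a i)) → AddChar (∀ i, ZMod (a i)) ℂ) := by
  intro x y hxy
  by_contra hne
  refine pairing_ne_zero_of_ne_zero (sub_ne_zero.2 hne) ?_
  ext z
  have h1 := pairing_add_left (x - y) y z
  rw [sub_add_cancel, hxy] at h1
  simpa [pairing_ne_zero] using h1

lemma exists_pairing_eq (χ : AddChar (∀ i, ZMod (a i)) ℂ) : ∃ y, ∀ x, χ x = pairing x y := by
  classical
  obtain ⟨y, hy⟩ := ((Fintype.bijective_iff_injective_and_card _).2
    ⟨pairing_injective (a := a), AddChar.card_eq.symm⟩).surjective χ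
  exact ⟨y, fun x => by rw [pairing_comm, hy]⟩

/-- A function that satisfies every additive relation between elements of `S` agrees on `S` with a
character. -/
lemma exists_pairing_of_closure {S : Set (∀ i, ZMod (a i))}
    {h : (∀ i, ZMod (a i)) → Additive ℂˣ}
    (H : ∀ γ ∈ AddSubgroup.closure ((fun s => (s, h s)) '' S), γ.1 = 0 → γ.2 = 0) :
    ∃ y, ∀ s ∈ S, (((h s).toMul : ℂˣ) : ℂ) = pairing s y := by
  let Γ := AddSubgroup.closure ((fun s => (s, h s)) '' S)
  let φ := (AddMonoidHom.fst (∀ i, ZMod (a i)) (Additive ℂˣ)).comp Γ.subtype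
  let ψ := (AddMonoidHom.snd (∀ i, ZMod (a i)) (Additive ℂˣ)).comp Γ.subtype
  let χ := φ.rangeRestrict.liftOfSurjective φ.rangeRestrict_surjective
    ⟨ψ, fun γ hγ => H γ γ.2 (congrArg Subtype.val hγ)⟩
  obtain ⟨η, hη⟩ := MonoidHom.domRestrict_surjective ℂ (AddSubgroup.toSubgroup φ.range)
    (AddMonoidHom.toMultiplicativeLeft χ)
  obtain ⟨y, hy⟩ := exists_pairing_eq
    (AddChar.toMonoidHomEquiv.symm ((Units.coeHom ℂ).comp η))
  refine ⟨y, fun s hs => ?_⟩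
  have hsΓ : (s, h s) ∈ Γ := AddSubgroup.subset_closure ⟨s, hs, rfl⟩
  have hχ : χ (φ.rangeRestrict ⟨_, hsΓ⟩) = h s :=
    AddMonoidHom.liftOfRightInverse_comp_apply _ _ _ _ _
  have h1 := DFunLike.congr_fun hη (⟨Multiplicative.ofAdd s, ⟨⟨_, hsΓ⟩, rfl⟩⟩)
  rw [← hy s, ← hχ]
  exact congrArg Units.val h1.symm

variable [DecidableEq ι]

/-- The Fourier transform with respect to `pairing`. -/
noncomputable def transform (f : (∀ i, ZMod (a i)) → ℂ) (x : ∀ i, ZMod (a i)) : ℂ :=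
  ∑ y, f y * pairing x y

lemma transform_comp_sub (f : (∀ i, ZMod (a i)) → ℂ) (x y : ∀ i, ZMod (a i)) :
    transform (fun z => f (z - y)) x = transform f x * pairing x y := by
  rw [transform, ← Equiv.sum_comp (Equiv.addRight y), transform, Finset.sum_mul]
  simp [AddChar.map_add_eq_mul, mul_assoc]

lemma transform_injective :
    Function.Injective (transform : ((∀ i, ZMod (a i)) → ℂ) → (∀ i, ZMod (a i)) → ℂ) := by
  classical
  have inv : ∀ (f : (∀ i, ZMod (a i)) → ℂ) z, ∑ x, transform f x * pairing x (-z) =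
      Fintype.card (∀ i, ZMod (a i)) * f z := fun f z => by
    have : ∀ y, ∑ x, pairing x y * pairing x (-z) =
        if y - z = 0 then (Fintype.card (∀ i, ZMod (a i)) : ℂ) else 0 := fun y => by
      simp_rw [← AddChar.map_add_eq_mul, ← sub_eq_add_neg, pairing_comm _ (y - z)]
      rw [AddChar.sum_eq_ite]
      refine if_congr ⟨fun h => ?_, fun h => ?_⟩ rfl rfl
      · by_contra h'
        exact pairing_ne_zero_of_ne_zero h' h
      · ext x
        rw [h, pairing_comm]
        simp
    simp_rw [transform, Finset.sum_mul]
    rw [Finset.sum_comm]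
    simp_rw [mul_assoc, ← Finset.mul_sum, this, sub_eq_zero]
    simp [mul_comm]
  intro f g hfg
  funext z
  have := inv f z
  rw [hfg, inv g z] at this
  exact (mul_left_cancel₀ (Nat.cast_ne_zero.2 Fintype.card_ne_zero) this).symm

/-- The transform of the autocorrelation of order `m + 1`. -/
lemma transform_mul_prod_transform (f : (∀ i, ZMod (a i)) → ℂ) {m : ℕ}
    (x : Fin m → ∀ i, ZMod (a i)) :
    transform f (-∑ j, x j) * ∏ j, transform f (x j) =
      ∑ z : Fin m → ∀ i, ZMod (a i), (∏ j, pairing (x j) (z j)) * autocorr f z := by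
  classical
  have shift : ∀ y j, transform f (x j) =
      ∑ z, pairing (x j) y * (pairing (x j) z * f (y + z)) := fun y j => by
    rw [transform, ← Equiv.sum_comp (Equiv.addLeft y)]
    refine Finset.sum_congr rfl fun z _ => ?_
    simp only [Equiv.coe_addLeft, AddChar.map_add_eq_mul]
    ring
  rw [transform, Finset.sum_mul]
  simp_rw [autocorr, Finset.mul_sum]
  rw [Finset.sum_comm]
  refine Finset.sum_congr rfl fun y _ => ?_
  simp_rw [shift y, ← Finset.mul_sum, Finset.prod_mul_distrib]
  rw [Finset.prod_univ_sum, Fintype.piFinset_univ, mul_assoc, ← mul_assoc (pairing _ y),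
    pairing_neg_sum, one_mul, Finset.mul_sum]
  refine Finset.sum_congr rfl fun z _ => ?_
  rw [Finset.prod_mul_distrib]
  ring

lemma prod_map_transform_eq {f g : (∀ i, ZMod (a i)) → ℂ} {n : ℕ}
    (H : ∀ m : ℕ, m + 1 ≤ n → ∀ x : Fin m → ∀ i, ZMod (a i), autocorr f x = autocorr g x)
    (L : List (∀ i, ZMod (a i))) (hL : L.length ≤ n) (h0 : L.sum = 0) :
    (L.map (transform f)).prod = (L.map (transform g)).prod := by
  cases L with
  | nil => rfl
  | cons x L =>
    have hx : x = -∑ j, L.get j := by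
      rw [eq_neg_iff_add_eq_zero, ← h0, List.sum_cons, ← List.sum_ofFn, List.ofFn_get]
    have key : ∀ f : (∀ i, ZMod (a i)) → ℂ, ((x :: L).map (transform f)).prod =
        ∑ z : Fin L.length → ∀ i, ZMod (a i),
          (∏ j, pairing (L.get j) (z j)) * autocorr f z := fun f => by
      rw [← transform_mul_prod_transform, ← hx, List.map_cons, List.prod_cons,
        ← List.prod_ofFn]
      congr 2
      conv_lhs => rw [← List.ofFn_get L, List.map_ofFn]
      rfl
    rw [key, key]
    simp_rw [H L.length hL]

/-- The zero set of the transform of a rational-valued function is stable under multiplication by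
units. -/
lemma transform_zsmul_eq_zero {f : (∀ i, ZMod (a i)) → ℂ} (hf : ∀ x, ∃ q : ℚ, f x = q)
    {N : ℕ} (hN : N ≠ 0) (hNG : ∀ x : ∀ i, ZMod (a i), N • x = 0) {u : ℤ} (hu : IsCoprime u N)
    {x : ∀ i, ZMod (a i)} (hx : transform f x = 0) : transform f (u • x) = 0 := by
  have : NeZero N := ⟨hN⟩
  have hNpos : 0 < N := Nat.pos_of_ne_zero hN
  obtain ⟨v, hv⟩ : ∃ v : ℕ, (v : ℤ) = u % N :=
    ⟨_, Int.toNat_of_nonneg (Int.emod_nonneg _ (by exact_mod_cast hN))⟩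
  have hvu : (v : ℤ) = u + N * (-(u / N)) := by
    rw [hv, Int.emod_def]; ring
  have hvN : v.Coprime N := by
    rw [← Nat.isCoprime_iff_coprime, hvu]
    exact hu.add_mul_left_left _
  have hvx : u • x = v • x := by
    rw [← natCast_zsmul, hvu, add_smul, mul_comm, mul_smul, natCast_zsmul, hNG]
    simp
  rw [hvx]
  have hζ := Complex.isPrimitiveRoot_exp N hN
  set ζ := Complex.exp (2 * Real.pi * Complex.I / N)
  have hroot : ∀ y, ∃ k, ζ ^ k = pairing x y := fun y => by
    obtain ⟨k, -, hk⟩ := hζ.eq_pow_of_pow_eq_one (ξ := pairing x y)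
      (by rw [← AddChar.map_nsmul_eq_pow, hNG, AddChar.map_zero_eq_one])
    exact ⟨k, hk⟩
  choose k hk using hroot
  choose q hq using hf
  let P : Polynomial ℚ := ∑ y, Polynomial.C (q y) * Polynomial.X ^ k y
  have hP : ∀ w : ℂ, Polynomial.aeval w P = ∑ y, f y * w ^ k y := fun w => by
    simp [P, hq]
  have hdvd : Polynomial.cyclotomic N ℚ ∣ P := by
    rw [Polynomial.cyclotomic_eq_minpoly_rat hζ hNpos]
    refine minpoly.dvd ℚ ζ ?_
    rw [hP, ← hx, transform]
    simp_rw [hk]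
  have hzero : Polynomial.aeval (ζ ^ v) P = 0 := by
    refine Polynomial.aeval_eq_zero_of_dvd_aeval_eq_zero hdvd ?_
    rw [Polynomial.cyclotomic_eq_minpoly_rat (hζ.pow_of_coprime v hvN) hNpos]
    exact minpoly.aeval ℚ _
  rw [← hzero, hP, transform]
  refine Finset.sum_congr rfl fun y _ => ?_
  rw [pairing_comm, AddChar.map_nsmul_eq_pow, pairing_comm, ← hk, ← pow_mul, ← pow_mul,
    mul_comm v]

end Fourier

theorem stmt10 {r : ℕ} (hr : 1 ≤ r) (a : Fin r → ℕ) [∀ i, NeZero (a i)]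
    (ha2 : ∀ i, 2 ≤ a i)
    (hdvd : ∀ i : Fin r, ∀ h : (i : ℕ) + 1 < r, a i ∣ a ⟨(i : ℕ) + 1, h⟩)
    (f g : (∀ i, ZMod (a i)) → ℂ)
    (hf : ∀ x, ∃ q : ℚ, f x = (q : ℂ)) (hg : ∀ x, ∃ q : ℚ, g x = (q : ℂ))
    (hcorr : ∀ m : ℕ, m + 1 ≤ 3 * r + 3 → ∀ x : Fin m → ∀ i, ZMod (a i),
      autocorr f x = autocorr g x) :
    ∃ y, ∀ x, g x = f (x + y) := by
  classical
  have : Nonempty (Fin r) := ⟨⟨0, hr⟩⟩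
  obtain ⟨N, hN, hNG⟩ : ∃ N : ℕ, N ≠ 0 ∧ ∀ x : ∀ i, ZMod (a i), N • x = 0 :=
    ⟨Fintype.card (∀ i, ZMod (a i)), Fintype.card_ne_zero, fun x => card_nsmul_eq_zero⟩
  have hstable : ∀ {f : (∀ i, ZMod (a i)) → ℂ}, (∀ x, ∃ q : ℚ, f x = (q : ℂ)) →
      ∀ x, transform f x ≠ 0 → ∀ u : ℤ, IsCoprime u N → transform f (u • x) ≠ 0 := by
    intro f hf x hx u hu h
    obtain ⟨v, w, hvw⟩ := hu
    refine hx ?_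
    have := transform_zsmul_eq_zero hf hN hNG (u := v) ⟨u, w, by rw [mul_comm u]; exact hvw⟩ h
    rwa [← mul_smul, eq_sub_of_add_eq hvw, sub_smul, mul_smul, natCast_zsmul, hNG, smul_zero,
      sub_zero, one_smul] at this
  have hprod := fun x => prod_map_transform_eq hcorr [x, -x] (by simp) (by simp)
  simp only [List.map_cons, List.map_nil, List.prod_cons, List.prod_nil, mul_one] at hprod
  have hneg : ∀ {f : (∀ i, ZMod (a i)) → ℂ}, (∀ x, ∃ q : ℚ, f x = (q : ℂ)) →
      ∀ x, transform f x ≠ 0 → transform f (-x) ≠ 0 := fun hf x hx => by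
    simpa using hstable hf x hx (-1) isCoprime_one_left.neg_left
  have hsupp : ∀ x, transform f x ≠ 0 ↔ transform g x ≠ 0 := fun x =>
    ⟨fun h => left_ne_zero_of_mul (hprod x ▸ mul_ne_zero h (hneg hf x h)),
      fun h => left_ne_zero_of_mul ((hprod x).symm ▸ mul_ne_zero h (hneg hg x h))⟩
  let q : (∀ i, ZMod (a i)) → Additive ℂˣ := fun x =>
    if hx : transform f x ≠ 0 then
      Additive.ofMul (Units.mk0 (transform g x / transform f x) (div_ne_zero ((hsupp x).1 hx) hx))
    else 0
  have hq : ∀ x, transform f x ≠ 0 →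
      transform g x = transform f x * ((q x).toMul : ℂˣ) := fun x hx => by
    simp only [q, dif_pos hx, toMul_ofMul, Units.val_mk0]
    field_simp
  have hrel : RespectsRelations {x | transform f x ≠ 0} q (3 * Fintype.card (Fin r) + 3) := by
    intro L hL hlen h0
    rw [Fintype.card_fin] at hlen
    have h1 := prod_map_transform_eq hcorr L hlen h0
    have h2 : (L.map (transform g)).prod =
        (L.map (transform f)).prod * ((L.map q).sum.toMul : ℂˣ) := by
      clear h0 h1 hlen
      induction L with
      | nil => simp
      | cons x L ih =>
        simp only [List.map_cons, List.prod_cons, List.sum_cons, toMul_add, Units.val_mul]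
        rw [ih fun y hy => hL y (List.mem_cons_of_mem _ hy), hq x (hL x List.mem_cons_self)]
        ring
    have h3 : (L.map (transform f)).prod ≠ 0 := List.prod_ne_zero fun h => by
      obtain ⟨x, hx, hx0⟩ := List.mem_map.1 h
      exact hL x hx hx0
    rw [← h1] at h2
    have h4 := mul_left_cancel₀ h3 ((mul_one _).trans h2)
    exact Additive.toMul.injective (Units.ext h4.symm)
  obtain ⟨y, hy⟩ := exists_pairing_of_closure fun γ hγ h0 =>
    hrel.snd_eq_zero hN hNG (hstable hf) hγ h0
  have hfg : g = fun z => f (z - y) := by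
    refine transform_injective (funext fun x => ?_)
    rw [transform_comp_sub]
    by_cases hx : transform f x = 0
    · rw [hx, zero_mul]
      exact not_not.1 fun h => (hsupp x).2 h hx
    · rw [hq x hx, hy x hx]
  exact ⟨-y, fun x => by rw [hfg, ← sub_eq_add_neg]⟩
end

section
/- Assume the invariant factor form: each a_i ≥ 2 and a_i divides a_{i+1} for all i < r−1, and assume additionally that |G| = a_0·a_1⋯a_{r−1} is odd. If f, g : G → ℂ are rational-valued and have the same autocorrelations up to order 2r+2, then g is a translation of f, i.e. there exists y ∈ G with g(x) = f(x+y) for all x ∈ G. -/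
open Complex Finset

/-- A rational linear relation among `L`-th roots of unity is preserved by raising these roots to
a power coprime to `L`. -/
theorem sum_rat_mul_pow_eq_zero {ι : Type*} [Fintype ι] {L t : ℕ} (hL : 0 < L)
    (ht : t.Coprime L) (q : ι → ℚ) (w : ι → ℂ) (hw : ∀ i, w i ^ L = 1)
    (h : ∑ i, (q i : ℂ) * w i = 0) : ∑ i, (q i : ℂ) * w i ^ t = 0 := by
  have : NeZero L := ⟨hL.ne'⟩
  have hζ := Complex.isPrimitiveRoot_exp L hL.ne'
  set ζ := Complex.exp (2 * Real.pi * Complex.I / L)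
  choose E _ hE using fun i => hζ.eq_pow_of_pow_eq_one (hw i)
  let P : Polynomial ℚ := ∑ i, Polynomial.C (q i) * Polynomial.X ^ E i
  have hP (z : ℂ) : Polynomial.aeval z P = ∑ i, (q i : ℂ) * z ^ E i := by
    simp [P, map_sum]
  have h0 : Polynomial.aeval ζ P = 0 := by
    rw [hP, ← h]
    exact Finset.sum_congr rfl fun i _ => by rw [hE]
  obtain ⟨Q, hQ⟩ := minpoly.dvd ℚ ζ h0
  rw [← Polynomial.cyclotomic_eq_minpoly_rat hζ hL,
    Polynomial.cyclotomic_eq_minpoly_rat (hζ.pow_of_coprime t ht) hL] at hQ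
  have h1 : Polynomial.aeval (ζ ^ t) P = 0 := by
    rw [hQ, map_mul, minpoly.aeval, zero_mul]
  rw [hP] at h1
  rw [← h1]
  exact Finset.sum_congr rfl fun i _ => by rw [← hE i, ← pow_mul, ← pow_mul, mul_comm t]

/-- Modulo an odd number, every element is a sum of two units. -/
theorem exists_coprime_add_coprime {L : ℕ} (hL : Odd L) (n : ℕ) :
    ∃ s t k : ℕ, s.Coprime L ∧ t.Coprime L ∧ s + t = n + L * k := by
  set u := ∏ p ∈ L.primeFactors with ¬ p ∣ n, p
  have key (p : ℕ) (hp : p.Prime) (hpL : p ∣ L) : p ∣ u ↔ ¬ p ∣ n := by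
    constructor
    · intro h
      obtain ⟨q, hq, hpq⟩ := (Prime.dvd_finsetProd_iff hp.prime _).1 h
      rw [Finset.mem_filter] at hq
      rw [(Nat.prime_dvd_prime_iff_eq hp (Nat.prime_of_mem_primeFactors hq.1)).1 hpq]
      exact hq.2
    · intro h
      exact Finset.dvd_prod_of_mem (fun p => p) (Finset.mem_filter.2
        ⟨Nat.mem_primeFactors.2 ⟨hp, hpL, hL.pos.ne'⟩, h⟩)
  have cop (c : ℕ) (hc : ∀ p, p.Prime → p ∣ L → ¬ p ∣ c) : (c * n + u).Coprime L := by
    by_contra hcon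
    obtain ⟨p, hp, h1, h2⟩ := Nat.Prime.not_coprime_iff_dvd.1 hcon
    by_cases hn : p ∣ n
    · exact (key p hp h2).1 ((Nat.dvd_add_right (hn.mul_left c)).1 h1) hn
    · have := (Nat.dvd_add_left ((key p hp h2).2 hn)).1 h1
      exact (hp.dvd_mul.1 this).elim (hc p hp h2) hn
  have h1 : (n + u).Coprime L := by
    simpa using cop 1 fun p hp _ => hp.one_lt.ne' ∘ Nat.dvd_one.1
  have h2 : (2 * n + u).Coprime L := cop 2 fun p hp hpL h => by
    rw [Nat.prime_dvd_prime_iff_eq hp Nat.prime_two] at h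
    subst h
    exact (Nat.not_even_iff_odd.2 hL) (even_iff_two_dvd.2 hpL)
  have h3 : (L - 1).Coprime L := by
    obtain ⟨m, rfl⟩ : ∃ m, L = m + 1 := ⟨L - 1, by have := hL.pos; omega⟩
    simp
  refine ⟨2 * n + u, (L - 1) * (n + u), n + u, h2, h3.mul_left h1, ?_⟩
  obtain ⟨m, rfl⟩ : ∃ m, L = m + 1 := ⟨L - 1, by have := hL.pos; omega⟩
  simp only [Nat.add_sub_cancel]
  ring

theorem exists_mul_eq_mul_of_finite {ι : Type*} [Finite ι] [Nonempty ι] {p : ℕ} (hp : p.Prime)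
    (b : ι → ℤ) : ∃ i₀, ∀ i, ∃ m c : ℤ, ¬ (p : ℤ) ∣ m ∧ m * b i = c * b i₀ := by
  obtain ⟨i₀, h₀⟩ := Finite.exists_min fun i => emultiplicity (p : ℤ) (b i)
  refine ⟨i₀, fun i => ?_⟩
  have hp1 : ¬ (p : ℤ) ∣ 1 := fun h => hp.one_lt.ne' (by
    have := Int.natCast_dvd_natCast.1 (by simpa using h : (p : ℤ) ∣ ((1 : ℕ) : ℤ))
    exact Nat.dvd_one.1 this)
  by_cases hfin : FiniteMultiplicity (p : ℤ) (b i₀)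
  · obtain ⟨c, hc, hpc⟩ := hfin.exists_eq_pow_mul_and_not_dvd
    have hd : (p : ℤ) ^ multiplicity (p : ℤ) (b i₀) ∣ b i := by
      apply pow_dvd_of_le_emultiplicity
      rw [← hfin.emultiplicity_eq_multiplicity]
      exact h₀ i
    obtain ⟨d, hd⟩ := hd
    refine ⟨c, d, hpc, ?_⟩
    rw [hd]
    linear_combination (-d) * hc
  · have h := h₀ i
    rw [emultiplicity_eq_top.2 hfin, top_le_iff, emultiplicity_eq_top] at h
    have zero (z : ℤ) (hz : ¬ FiniteMultiplicity (p : ℤ) z) : z = 0 := by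
      by_contra hne
      exact hz (Int.finiteMultiplicity_iff.2 ⟨by simpa using hp.ne_one, hne⟩)
    exact ⟨1, 0, hp1, by rw [zero _ h, zero _ hfin]; simp⟩

/-- Finitely many vectors of `ℤ ^ r` are spanned, locally at `p`, by `r` of them. -/
theorem exists_smul_eq_sum_smul {ι : Type*} [Finite ι] [Nonempty ι] {p : ℕ} (hp : p.Prime)
    {r : ℕ} (v : ι → Fin r → ℤ) :
    ∃ j : Fin r → ι, ∀ i, ∃ (m : ℤ) (n : Fin r → ℤ), ¬ (p : ℤ) ∣ m ∧
      m • v i = ∑ l, n l • v (j l) := by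
  have hp' : Prime (p : ℤ) := Nat.prime_iff_prime_int.1 hp
  induction r with
  | zero =>
    exact ⟨Fin.elim0, fun i => ⟨1, 0, fun h => hp'.not_isUnit (isUnit_of_dvd_one h),
      Subsingleton.elim _ _⟩⟩
  | succ r ih =>
    obtain ⟨i₀, h₀⟩ := exists_mul_eq_mul_of_finite hp fun i => v i 0
    choose m c hm hmc using h₀
    obtain ⟨j, hj⟩ := ih fun i l => m i * v i l.succ - c i * v i₀ l.succ
    refine ⟨Fin.cons i₀ j, fun i => ?_⟩
    obtain ⟨m', n, hm', hn⟩ := hj i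
    refine ⟨m' * m i, Fin.cons (m' * c i - ∑ l, n l * c (j l)) fun l => n l * m (j l),
      fun h => (hp'.dvd_or_dvd h).elim hm' (hm i), ?_⟩
    have key (k : Fin (r + 1)) : m' * (m i * v i k - c i * v i₀ k) =
        ∑ l, n l * (m (j l) * v (j l) k - c (j l) * v i₀ k) := by
      refine Fin.cases ?_ (fun k => ?_) k
      · simp [hmc]
      · simpa using congrFun hn k
    funext k
    have hk := key k
    simp only [mul_sub, Finset.sum_sub_distrib] at hk
    simp only [Fin.sum_univ_succ, Fin.cons_zero, Fin.cons_succ, Pi.smul_apply,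
      Finset.sum_apply, smul_eq_mul, sub_mul, Finset.sum_mul, mul_assoc]
    linarith

section Pairing

variable {G : Type*} [AddCommGroup G] [Fintype G]

/-- The Fourier transform of `f` with respect to a pairing `e` of `G` with itself. -/
noncomputable def pairingDFT (e : G →+ AddChar G ℂ) (f : G → ℂ) (x : G) : ℂ :=
  ∑ y, f y * e x y

theorem pairingDFT_neg_sum_mul_prod (e : G →+ AddChar G ℂ) (f : G → ℂ) {m : ℕ}
    (x : Fin m → G) :
    pairingDFT e f (-∑ j, x j) * ∏ j, pairingDFT e f (x j) =
      ∑ z : Fin m → G, (∏ j, e (x j) (z j)) * autocorr f z := by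
  classical
  have h1 (y : G) : ∏ j, pairingDFT e f (x j) =
      e (∑ j, x j) y * ∑ z : Fin m → G, ∏ j, (f (y + z j) * e (x j) (z j)) := by
    rw [← Fintype.prod_sum fun j z => f (y + z) * e (x j) z, map_sum, AddChar.sum_apply,
      ← Finset.prod_mul_distrib]
    refine Finset.prod_congr rfl fun j _ => ?_
    rw [pairingDFT, ← Equiv.sum_comp (Equiv.addLeft y), Finset.mul_sum]
    refine Finset.sum_congr rfl fun z _ => ?_
    simp only [Equiv.coe_addLeft, AddChar.map_add_eq_mul]
    ring
  rw [pairingDFT, Finset.sum_mul]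
  simp_rw [autocorr, Finset.mul_sum]
  rw [Finset.sum_comm]
  refine Finset.sum_congr rfl fun y _ => ?_
  rw [h1 y, ← mul_assoc, mul_assoc (f y), ← AddChar.add_apply, ← map_add, neg_add_cancel,
    map_zero, AddChar.zero_apply, mul_one, Finset.mul_sum]
  refine Finset.sum_congr rfl fun z _ => ?_
  rw [Finset.prod_mul_distrib]
  ring

theorem prod_pairingDFT_eq (e : G →+ AddChar G ℂ) {f g : G → ℂ} {n : ℕ}
    (h : ∀ m : ℕ, m + 1 ≤ n → ∀ x : Fin m → G, autocorr f x = autocorr g x)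
    {ι : Type*} [Fintype ι] (hι : Fintype.card ι ≤ n) (w : ι → G) (hw : ∑ i, w i = 0) :
    ∏ i, pairingDFT e f (w i) = ∏ i, pairingDFT e g (w i) := by
  obtain ⟨k, hk⟩ : ∃ k, Fintype.card ι = k := ⟨_, rfl⟩
  have σ := (Fintype.equivFinOfCardEq hk).symm
  rw [← Equiv.sum_comp σ] at hw
  rw [← Equiv.prod_comp σ, ← Equiv.prod_comp σ (fun i => pairingDFT e g (w i))]
  cases k with
  | zero => simp
  | succ k =>
    rw [Fin.sum_univ_succ] at hw
    rw [Fin.prod_univ_succ, Fin.prod_univ_succ, eq_neg_of_add_eq_zero_left hw,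
      pairingDFT_neg_sum_mul_prod e f (fun j : Fin k => w (σ j.succ)),
      pairingDFT_neg_sum_mul_prod e g (fun j : Fin k => w (σ j.succ))]
    exact Finset.sum_congr rfl fun z _ => by rw [h k (hk ▸ hι)]

theorem pairingDFT_injective {e : G →+ AddChar G ℂ} (he : Function.Injective e)
    (hs : ∀ x y, e x y = e y x) : Function.Injective (pairingDFT e) := by
  classical
  intro f g hfg
  have key (f : G → ℂ) (z : G) : ∑ x, pairingDFT e f x * e (-z) x = Fintype.card G * f z := by
    simp_rw [pairingDFT, Finset.sum_mul]
    rw [Finset.sum_comm]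
    have (y : G) : ∑ x, f y * e x y * e (-z) x =
        f y * if y = z then (Fintype.card G : ℂ) else 0 := by
      simp_rw [mul_assoc, hs _ y, ← AddChar.add_apply, ← map_add]
      rw [← Finset.mul_sum, AddChar.sum_eq_ite]
      simp only [map_eq_zero_iff e he, ← sub_eq_add_neg, sub_eq_zero]
    rw [Finset.sum_congr rfl fun y _ => this y]
    simp [mul_comm]
  funext z
  have hz := key f z
  rw [hfg, key g z] at hz
  exact (mul_left_cancel₀ (by simp) hz).symm

theorem pairing_pow_eq_one (e : G →+ AddChar G ℂ) {L : ℕ} (hL : Fintype.card G ∣ L) (x y : G) :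
    e x y ^ L = 1 := by
  obtain ⟨k, rfl⟩ := hL
  rw [← AddChar.map_nsmul_eq_pow, mul_nsmul, card_nsmul_eq_zero, smul_zero,
    AddChar.map_zero_eq_one]

/-- A family of roots of unity satisfying all relations of a family of elements of `G` is the
restriction of a character. -/
theorem exists_pairing_eq_s11 {e : G →+ AddChar G ℂ} (he : Function.Injective e)
    {L : ℕ} (hL0 : 0 < L) (hL : Fintype.card G ∣ L) {ι : Type*} [Fintype ι] (s : ι → G)
    (u : ι → ℂ) (hu : ∀ i, u i ^ L = 1)
    (hrel : ∀ k : ι → ℕ, ∑ i, k i • s i = 0 → ∏ i, u i ^ k i = 1) :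
    ∃ y, ∀ i, e (s i) y = u i := by
  classical
  by_contra! hno
  have hu0 (i : ι) : u i ≠ 0 := fun h => by simpa [h, hL0.ne'] using hu i
  have hzero (y : G) : ∏ i, ∑ k ∈ Finset.range L, (e (s i) y / u i) ^ k = 0 := by
    obtain ⟨i, hi⟩ := hno y
    refine Finset.prod_eq_zero (Finset.mem_univ i) ?_
    rw [geom_sum_eq (by rwa [ne_eq, div_eq_one_iff_eq (hu0 i)]), div_pow, hu,
      pairing_pow_eq_one e hL]
    simp
  have hterm (k : ι → ℕ) : ∑ y, ∏ i, (e (s i) y / u i) ^ k i =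
      if ∑ i, k i • s i = 0 then (Fintype.card G : ℂ) else 0 := by
    have (y : G) : ∏ i, (e (s i) y / u i) ^ k i =
        e (∑ i, k i • s i) y * (∏ i, u i ^ k i)⁻¹ := by
      simp only [map_sum, AddChar.sum_apply, map_nsmul, AddChar.nsmul_apply, div_pow,
        Finset.prod_div_distrib]
      exact div_eq_mul_inv _ _
    simp_rw [this, ← Finset.sum_mul, AddChar.sum_eq_ite, map_eq_zero_iff e he]
    split_ifs with h
    · simp [hrel k h]
    · simp
  have hsum : ∑ y : G, ∏ i, ∑ k ∈ Finset.range L, (e (s i) y / u i) ^ k = 0 :=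
    Finset.sum_eq_zero fun y _ => hzero y
  simp_rw [Finset.prod_univ_sum] at hsum
  rw [Finset.sum_comm] at hsum
  simp_rw [hterm, ← Finset.sum_filter, Finset.sum_const, nsmul_eq_mul] at hsum
  rw [mul_eq_zero, or_iff_left (by simp), Nat.cast_eq_zero, Finset.card_eq_zero] at hsum
  refine Finset.notMem_empty (0 : ι → ℕ) (hsum ▸ ?_)
  simp [hL0]

end Pairing

theorem pairingDFT_nsmul_eq_pow_mul
    {G : Type*} [AddCommGroup G] [Fintype G] (e : G →+ AddChar G ℂ) {L t : ℕ} (hL0 : 0 < L)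
    (hL : Fintype.card G ∣ L) (ht : t.Coprime L) {f g : G → ℂ}
    (hf : ∀ x, ∃ q : ℚ, f x = q) (hg : ∀ x, ∃ q : ℚ, g x = q) {c : ℂ} (hc : c ^ L = 1) {x : G}
    (h : pairingDFT e g x = c * pairingDFT e f x) :
    pairingDFT e g (t • x) = c ^ t * pairingDFT e f (t • x) := by
  choose p hp using hf
  choose q hq using hg
  have := sum_rat_mul_pow_eq_zero hL0 ht (Sum.elim q fun y => -p y)
    (Sum.elim (e x) fun y => c * e x y) (by
      rintro (y | y)
      · simp [pairing_pow_eq_one e hL]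
      · simp [mul_pow, hc, pairing_pow_eq_one e hL]) (by
      simp only [pairingDFT, Finset.mul_sum, hp, hq] at h
      simp only [Fintype.sum_sum_type, Sum.elim_inl, Sum.elim_inr, h, Rat.cast_neg, neg_mul,
        Finset.sum_neg_distrib]
      rw [← sub_eq_add_neg, sub_eq_zero]
      exact Finset.sum_congr rfl fun y _ => by ring)
  simp only [Fintype.sum_sum_type, Sum.elim_inl, Sum.elim_inr, Rat.cast_neg, neg_mul,
    Finset.sum_neg_distrib] at this
  rw [← sub_eq_add_neg, sub_eq_zero] at this
  simp only [pairingDFT, Finset.mul_sum, hp, hq, map_nsmul, AddChar.nsmul_apply, this]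
  exact Finset.sum_congr rfl fun y _ => by ring

theorem pow_totient_nsmul {G : Type*} [AddCommGroup G] [Fintype G] {t : ℕ}
    (ht : t.Coprime (Fintype.card G)) (x : G) : t ^ (Fintype.card G).totient • x = x := by
  rw [← one_nsmul x, ← mul_smul, mul_one]
  exact nsmul_eq_nsmul_iff_modEq.2
    ((Nat.ModEq.pow_totient ht).of_dvd addOrderOf_dvd_card)

theorem pairingDFT_nsmul_ne_zero {G : Type*} [AddCommGroup G] [Fintype G]
    (e : G →+ AddChar G ℂ) {f : G → ℂ} (hf : ∀ x, ∃ q : ℚ, f x = q) {t : ℕ}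
    (ht : t.Coprime (Fintype.card G)) {x : G} (hx : pairingDFT e f x ≠ 0) :
    pairingDFT e f (t • x) ≠ 0 := by
  intro h
  have h0 (x : G) : pairingDFT e 0 x = 0 := by simp [pairingDFT]
  have hzero := pairingDFT_nsmul_eq_pow_mul e Fintype.card_pos dvd_rfl
    (ht.pow_left ((Fintype.card G).totient - 1)) (f := 0) (fun _ => ⟨0, by simp⟩) hf (one_pow _)
    (x := t • x) (by rw [h, h0, mul_zero])
  rw [← mul_smul, ← pow_succ, Nat.sub_add_cancel (Nat.totient_pos.2 Fintype.card_pos),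
    pow_totient_nsmul ht] at hzero
  exact hx (by rw [hzero, h0, mul_zero])

section Ratio

variable {G : Type*} [AddCommGroup G] {F H : G → ℂ} {n : ℕ}

theorem neg_ne_zero_of_nsmul [Fintype G]
    (hF : ∀ t : ℕ, t.Coprime (Fintype.card G) → ∀ x, F x ≠ 0 → F (t • x) ≠ 0)
    {x : G} (hx : F x ≠ 0) : F (-x) ≠ 0 := by
  have h : (Fintype.card G - 1).Coprime (Fintype.card G) := by
    obtain ⟨m, hm⟩ : ∃ m, Fintype.card G = m + 1 :=
      ⟨Fintype.card G - 1, by have := Fintype.card_pos (α := G); omega⟩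
    simp [hm]
  have hneg : (Fintype.card G - 1) • x = -x := eq_neg_of_add_eq_zero_left (by
    rw [← succ_nsmul, Nat.sub_add_cancel Fintype.card_pos, card_nsmul_eq_zero])
  exact hneg ▸ hF _ h x hx

theorem ne_zero_of_prod_eq (hn : 2 ≤ n)
    (h : ∀ (ι : Type) [Fintype ι] (w : ι → G), Fintype.card ι ≤ n → ∑ i, w i = 0 →
      ∏ i, F (w i) = ∏ i, H (w i))
    {x : G} (hx : F x ≠ 0) (hnx : F (-x) ≠ 0) : H x ≠ 0 := by
  have h2 := h (Fin 2) ![x, -x] (by simpa using hn) (by simp)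
  simp only [Fin.prod_univ_two, Matrix.cons_val_zero, Matrix.cons_val_one] at h2
  intro hH
  rw [hH, zero_mul] at h2
  exact mul_ne_zero hx hnx h2

theorem ratio_two_nsmul (hn : 3 ≤ n)
    (h : ∀ (ι : Type) [Fintype ι] (w : ι → G), Fintype.card ι ≤ n → ∑ i, w i = 0 →
      ∏ i, F (w i) = ∏ i, H (w i))
    {x : G} (hx : F x ≠ 0) (hHnx : H (-x) ≠ 0) (hx2 : F (2 • x) ≠ 0) :
    H (2 • x) / F (2 • x) = (H x / F x) ^ 2 := by
  have h2 := h (Fin 2) ![x, -x] (by simp; omega) (by simp)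
  have h3 := h (Fin 3) ![2 • x, -x, -x] (by simpa using hn)
    (by simp [Fin.sum_univ_three, two_nsmul])
  simp only [Fin.prod_univ_two, Fin.prod_univ_three, Matrix.cons_val] at h2 h3
  field_simp
  have : H (-x) ^ 2 ≠ 0 := pow_ne_zero 2 hHnx
  apply mul_right_cancel₀ this
  linear_combination (-(F x) ^ 2) * h3 + F (2 • x) * (F x * F (-x) + H x * H (-x)) * h2

theorem ratio_pow_eq_one [Fintype G] (hn : 3 ≤ n) (hodd : Odd (Fintype.card G))
    (h : ∀ (ι : Type) [Fintype ι] (w : ι → G), Fintype.card ι ≤ n → ∑ i, w i = 0 →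
      ∏ i, F (w i) = ∏ i, H (w i))
    (hF : ∀ t : ℕ, t.Coprime (Fintype.card G) → ∀ x, F x ≠ 0 → F (t • x) ≠ 0)
    {x : G} (hx : F x ≠ 0) : (H x / F x) ^ (2 ^ (Fintype.card G).totient - 1) = 1 := by
  have h2 : Nat.Coprime 2 (Fintype.card G) := Nat.coprime_two_left.2 hodd
  have hH {x : G} (hx : F x ≠ 0) : H x ≠ 0 :=
    ne_zero_of_prod_eq (by omega) h hx (neg_ne_zero_of_nsmul hF hx)
  have hk (k : ℕ) : F (2 ^ k • x) ≠ 0 ∧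
      H (2 ^ k • x) / F (2 ^ k • x) = (H x / F x) ^ 2 ^ k := by
    induction k with
    | zero => simpa using hx
    | succ k ih =>
      have hx2 := hF 2 h2 _ ih.1
      rw [pow_succ, mul_comm, mul_smul, mul_comm, pow_mul, ← ih.2]
      exact ⟨hx2, ratio_two_nsmul hn h ih.1 (hH (neg_ne_zero_of_nsmul hF ih.1)) hx2⟩
  have := (hk (Fintype.card G).totient).2
  rw [pow_totient_nsmul h2] at this
  apply mul_right_cancel₀ (div_ne_zero (hH hx) hx)
  rw [← pow_succ, Nat.sub_add_cancel Nat.one_le_two_pow, ← this, one_mul]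

theorem prod_ratio_zpow_eq_one {L : ℕ} (hL : Odd L) (hLG : ∀ x : G, L • x = 0)
    (h : ∀ (ι : Type) [Fintype ι] (w : ι → G), Fintype.card ι ≤ n → ∑ i, w i = 0 →
      ∏ i, F (w i) = ∏ i, H (w i))
    (hpow : ∀ x, F x ≠ 0 → (H x / F x) ^ L = 1)
    (hF : ∀ t : ℕ, t.Coprime L → ∀ x, F x ≠ 0 →
      F (t • x) ≠ 0 ∧ H (t • x) / F (t • x) = (H x / F x) ^ t)
    {ι : Type} [Fintype ι] (hι : 2 * Fintype.card ι ≤ n) (x : ι → G) (hx : ∀ i, F (x i) ≠ 0)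
    (k : ι → ℤ) (hk : ∑ i, k i • x i = 0) : ∏ i, (H (x i) / F (x i)) ^ k i = 1 := by
  have hL0 : (L : ℤ) ≠ 0 := by exact_mod_cast hL.pos.ne'
  have hmod (i : ι) : ((k i % L).toNat : ℤ) = k i - L * (k i / L) := by
    rw [Int.toNat_of_nonneg (Int.emod_nonneg _ hL0), Int.emod_def]
  choose s t c hs ht hst using fun i => exists_coprime_add_coprime hL (k i % L).toNat
  have hst' (i : ι) : (s i : ℤ) + t i = k i + L * (c i - k i / L) := by
    have : ((s i + t i : ℕ) : ℤ) = _ := congrArg _ (hst i)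
    push_cast at this
    rw [this]
    rw [hmod]
    ring
  have hsum : ∑ i, Sum.elim (fun i => s i • x i) (fun i => t i • x i) i = 0 := by
    rw [Fintype.sum_sum_type, ← hk, ← Finset.sum_add_distrib]
    refine Finset.sum_congr rfl fun i _ => ?_
    simp only [Sum.elim_inl, Sum.elim_inr]
    rw [← natCast_zsmul, ← natCast_zsmul, ← add_zsmul, hst', add_zsmul, mul_comm, mul_zsmul,
      natCast_zsmul, hLG, smul_zero, add_zero]
  have hprod := h (ι ⊕ ι) _ (by rw [Fintype.card_sum]; omega) hsum
  simp only [Fintype.prod_sum_type, Sum.elim_inl, Sum.elim_inr] at hprod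
  have hterm (i : ι) : (H (x i) / F (x i)) ^ k i =
      H (s i • x i) * H (t i • x i) / (F (s i • x i) * F (t i • x i)) := by
    have hu : H (x i) / F (x i) ≠ 0 := fun h0 => by
      have := hpow _ (hx i)
      rw [h0, zero_pow hL.pos.ne'] at this
      exact zero_ne_one this
    rw [mul_div_mul_comm, (hF _ (hs i) _ (hx i)).2, (hF _ (ht i) _ (hx i)).2, ← pow_add,
      ← zpow_natCast, Nat.cast_add, hst', zpow_add₀ hu, zpow_mul, zpow_natCast, hpow _ (hx i),
      one_zpow, mul_one]
  simp_rw [hterm]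
  rw [Finset.prod_div_distrib, Finset.prod_mul_distrib, Finset.prod_mul_distrib, hprod, div_self]
  rw [← hprod]
  exact mul_ne_zero (Finset.prod_ne_zero_iff.2 fun i _ => (hF _ (hs i) _ (hx i)).1)
    (Finset.prod_ne_zero_iff.2 fun i _ => (hF _ (ht i) _ (hx i)).1)

end Ratio

/-- If `G` is generated by `r` elements, relations among elements of `G` are detected by
relations of length at most `r + 1`. -/
theorem prod_zpow_eq_one_of_short_relations {G A : Type*} [AddCommGroup G] [CommGroup A] {r : ℕ}
    {π : (Fin r → ℤ) →+ G} (hπ : Function.Surjective π) {ι : Type*} [Fintype ι]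
    (s : ι → G) (u : ι → A)
    (h : ∀ (κ : Type) [Fintype κ], Fintype.card κ ≤ r + 1 → ∀ (j : κ → ι) (k : κ → ℤ),
      ∑ i, k i • s (j i) = 0 → ∏ i, u (j i) ^ k i = 1)
    (k : ι → ℤ) (hk : ∑ i, k i • s i = 0) : ∏ i, u i ^ k i = 1 := by
  classical
  cases isEmpty_or_nonempty ι
  · simp
  rw [← orderOf_eq_one_iff]
  by_contra hne
  obtain ⟨p, hp, hpc⟩ := Nat.exists_prime_and_dvd hne
  choose v hv using fun i => hπ (s i)
  obtain ⟨j, hj⟩ := exists_smul_eq_sum_smul hp v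
  choose m n hm hmn using hj
  have hs (i : ι) : m i • s i = ∑ l, n i l • s (j l) := by
    simpa only [map_zsmul, map_sum, hv] using congrArg π (hmn i)
  have hu (i : ι) : u i ^ m i = ∏ l, u (j l) ^ n i l := by
    have := h (Option (Fin r)) (by simp) (fun o => o.elim i j)
      (fun o => o.elim (-m i) (n i)) (by simp [Fintype.sum_option, hs])
    simp only [Fintype.prod_option, Option.elim_none, Option.elim_some, zpow_neg] at this
    exact (inv_mul_eq_one.1 this)
  choose q hq using fun i => Finset.dvd_prod_of_mem m (Finset.mem_univ i)
  set M := ∏ i, m i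
  have hM : (∏ i, u i ^ k i) ^ M = 1 := by
    rw [← h (Fin r) (by simp) j (fun l => ∑ i, n i l * (q i * k i))]
    · have (i : ι) : (u i ^ k i) ^ M = ∏ l, u (j l) ^ (n i l * (q i * k i)) := by
        simp_rw [zpow_mul _ (n i _), Finset.prod_zpow, ← hu, ← zpow_mul]
        rw [hq i]
        congr 1
        ring
      rw [← Finset.prod_zpow]
      simp_rw [this]
      rw [Finset.prod_comm]
      exact Finset.prod_congr rfl fun l _ =>
        (map_sum (zpowersHom A (u (j l))).toAdditiveRight _ _).symm
    · simp_rw [Finset.sum_smul]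
      rw [Finset.sum_comm]
      have (i : ι) : ∑ l, (n i l * (q i * k i)) • s (j l) = M • k i • s i := by
        simp_rw [mul_comm (n i _), mul_smul (q i * k i), ← Finset.smul_sum, ← hs, ← mul_smul]
        rw [hq i]
        congr 1
        ring
      simp_rw [this, ← Finset.smul_sum, hk, smul_zero]
  have hdvd : (p : ℤ) ∣ M := (Int.natCast_dvd_natCast.2 hpc).trans
    (orderOf_dvd_iff_zpow_eq_one.2 hM)
  obtain ⟨i, _, hi⟩ := ((Nat.prime_iff_prime_int.1 hp).dvd_finsetProd_iff _).1 hdvd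
  exact hm i hi

/-- Rational-valued functions on an abelian group of odd order generated by `r` elements are
determined up to translation by their autocorrelations up to order `2 * r + 2`. -/
theorem exists_translation_of_autocorr_eq {G : Type*} [AddCommGroup G] [Fintype G]
    (hodd : Odd (Fintype.card G)) {r : ℕ} (hr : 1 ≤ r) {π : (Fin r → ℤ) →+ G}
    (hπ : Function.Surjective π) {e : G →+ AddChar G ℂ} (he : Function.Injective e)
    (hs : ∀ x y, e x y = e y x) {f g : G → ℂ} (hf : ∀ x, ∃ q : ℚ, f x = q)
    (hg : ∀ x, ∃ q : ℚ, g x = q)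
    (hcorr : ∀ m : ℕ, m + 1 ≤ 2 * r + 2 → ∀ x : Fin m → G, autocorr f x = autocorr g x) :
    ∃ y, ∀ x, g x = f (x + y) := by
  set F := pairingDFT e f with hFdef
  set H := pairingDFT e g
  have h (ι : Type) [Fintype ι] (w : ι → G) (hι : Fintype.card ι ≤ 2 * r + 2)
      (hw : ∑ i, w i = 0) : ∏ i, F (w i) = ∏ i, H (w i) := prod_pairingDFT_eq e hcorr hι w hw
  have hF (t : ℕ) (ht : t.Coprime (Fintype.card G)) (x : G) (hx : F x ≠ 0) : F (t • x) ≠ 0 :=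
    pairingDFT_nsmul_ne_zero e hf ht hx
  have hG (t : ℕ) (ht : t.Coprime (Fintype.card G)) (x : G) (hx : H x ≠ 0) : H (t • x) ≠ 0 :=
    pairingDFT_nsmul_ne_zero e hg ht hx
  have hFH (x : G) (hx : F x ≠ 0) : H x ≠ 0 :=
    ne_zero_of_prod_eq (by omega) h hx (neg_ne_zero_of_nsmul hF hx)
  have hHF (x : G) (hx : H x ≠ 0) : F x ≠ 0 :=
    ne_zero_of_prod_eq (by omega) (fun ι _ w hι hw => (h ι w hι hw).symm) hx
      (neg_ne_zero_of_nsmul hG hx)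
  obtain ⟨L, hL, hLG, hpow⟩ : ∃ L, Odd L ∧ Fintype.card G ∣ L ∧
      ∀ x, F x ≠ 0 → (H x / F x) ^ L = 1 := by
    refine ⟨Fintype.card G * (2 ^ (Fintype.card G).totient - 1), hodd.mul ?_, dvd_mul_right _ _,
      fun x hx => ?_⟩
    · exact Nat.Even.sub_odd Nat.one_le_two_pow
        (even_two.pow_of_ne_zero (Nat.totient_pos.2 Fintype.card_pos).ne') odd_one
    · rw [mul_comm, pow_mul, ratio_pow_eq_one (by omega) hodd h hF hx, one_pow]
  have hratio (t : ℕ) (ht : t.Coprime L) (x : G) (hx : F x ≠ 0) :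
      F (t • x) ≠ 0 ∧ H (t • x) / F (t • x) = (H x / F x) ^ t := by
    have htx := hF t (ht.coprime_dvd_right hLG) x hx
    exact ⟨htx, (div_eq_iff htx).2 (pairingDFT_nsmul_eq_pow_mul e hL.pos hLG ht hf hg
      (hpow x hx) (div_mul_cancel₀ _ hx).symm)⟩
  have hLsmul (x : G) : L • x = 0 := by
    obtain ⟨k, rfl⟩ := hLG
    rw [mul_nsmul, card_nsmul_eq_zero, smul_zero]
  classical
  let u (s : {x // F x ≠ 0}) : ℂˣ := Units.mk0 (H s / F s) (div_ne_zero (hFH s s.2) s.2)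
  obtain ⟨y, hy⟩ := exists_pairing_eq_s11 he hL.pos hLG (fun s : {x // F x ≠ 0} => (s : G))
    (fun s => (u s : ℂ)) (fun s => hpow s s.2) fun k hk => by
      have := prod_zpow_eq_one_of_short_relations hπ (fun s : {x // F x ≠ 0} => (s : G)) u
        (fun κ _ hκ j k hk => Units.ext (by
          simpa [u] using prod_ratio_zpow_eq_one hL hLsmul h hpow hratio (by omega)
            (fun i => (j i : G)) (fun i => (j i).2) k hk)) (fun s => k s) (by simpa using hk)
      simpa using congrArg Units.val this
  have hshift : pairingDFT e (fun x => f (x - y)) = H := by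
    funext x
    have : pairingDFT e (fun x => f (x - y)) x = e x y * F x := by
      rw [pairingDFT, ← Equiv.sum_comp (Equiv.addRight y), hFdef, pairingDFT, Finset.mul_sum]
      refine Finset.sum_congr rfl fun z _ => ?_
      simp only [Equiv.coe_addRight, add_sub_cancel_right, AddChar.map_add_eq_mul]
      ring
    rw [this]
    by_cases hx : F x = 0
    · rw [hx, mul_zero, not_not.1 (mt (hHF x) (not_not.2 hx))]
    · rw [hy ⟨x, hx⟩]
      exact div_mul_cancel₀ _ hx
  refine ⟨-y, fun x => ?_⟩
  rw [← sub_eq_add_neg, ← pairingDFT_injective he hs hshift]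

/-- The standard pairing of `∏ i, ZMod (a i)` with itself. -/
noncomputable def zmodPiPairing {r : ℕ} (a : Fin r → ℕ) [∀ i, NeZero (a i)] :
    (∀ i, ZMod (a i)) →+ AddChar (∀ i, ZMod (a i)) ℂ where
  toFun x :=
    { toFun := fun y => ∏ i, ZMod.stdAddChar (x i * y i)
      map_zero_eq_one' := by simp
      map_add_eq_mul' := fun y z => by
        simp [mul_add, AddChar.map_add_eq_mul, Finset.prod_mul_distrib] }
  map_zero' := by ext; simp
  map_add' x y := by
    ext z
    simp [add_mul, AddChar.map_add_eq_mul, Finset.prod_mul_distrib]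

theorem zmodPiPairing_apply {r : ℕ} (a : Fin r → ℕ) [∀ i, NeZero (a i)]
    (x y : ∀ i, ZMod (a i)) : zmodPiPairing a x y = ∏ i, ZMod.stdAddChar (x i * y i) := rfl

theorem zmodPiPairing_injective {r : ℕ} (a : Fin r → ℕ) [∀ i, NeZero (a i)] :
    Function.Injective (zmodPiPairing a) := by
  rw [injective_iff_map_eq_zero]
  intro x hx
  funext i
  have h : ∏ k, ZMod.stdAddChar (x k * (Pi.single i 1 : ∀ i, ZMod (a i)) k) = 1 :=
    DFunLike.congr_fun hx _
  rw [Finset.prod_eq_single i (fun k _ hk => by simp [Pi.single_eq_of_ne hk]) (by simp),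
    Pi.single_eq_same, mul_one] at h
  exact ZMod.injective_stdAddChar (h.trans (AddChar.map_zero_eq_one _).symm)

theorem stmt11 {r : ℕ} (hr : 1 ≤ r) (a : Fin r → ℕ) [∀ i, NeZero (a i)]
    (ha2 : ∀ i, 2 ≤ a i)
    (hdvd : ∀ i : Fin r, ∀ h : (i : ℕ) + 1 < r, a i ∣ a ⟨(i : ℕ) + 1, h⟩)
    (hodd : Odd (∏ i, a i))
    (f g : (∀ i, ZMod (a i)) → ℂ)
    (hf : ∀ x, ∃ q : ℚ, f x = (q : ℂ)) (hg : ∀ x, ∃ q : ℚ, g x = (q : ℂ))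
    (hcorr : ∀ m : ℕ, m + 1 ≤ 2 * r + 2 → ∀ x : Fin m → ∀ i, ZMod (a i),
      autocorr f x = autocorr g x) :
    ∃ y, ∀ x, g x = f (x + y) := by
  refine exists_translation_of_autocorr_eq (by simpa [Fintype.card_pi, ZMod.card] using hodd) hr
    (π := AddMonoidHom.pi fun i => (Int.castAddHom (ZMod (a i))).comp (Pi.evalAddMonoidHom _ i))
    (fun x => ⟨fun i => ((x i).val : ℤ), ?_⟩) (zmodPiPairing_injective a)
    (fun x y => by simp only [zmodPiPairing_apply, mul_comm]) hf hg hcorr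
  funext i
  change (((x i).val : ℤ) : ZMod (a i)) = x i
  simp
end

section
/- Suppose N = exp(G) ≥ 2. Then there exists a function f : G → ℂ which is not identically zero such that M_n(f; x_1,…,x_{n−1}) = 0 for every 1 ≤ n ≤ N−1 and all x_1,…,x_{n−1} ∈ G. In particular, f and the zero function have the same autocorrelations up to order exp(G)−1 but are not translations of each other. -/
open Complex Finset

/-- The autocorrelations of an additive character `ψ` vanish in every order `n` with
`ψ ^ n ≠ 1`. -/
lemma autocorr_addChar_eq_zero {G : Type*} [AddCommGroup G] [Fintype G] (ψ : AddChar G ℂ) {m : ℕ}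
    (hψ : ψ ^ (m + 1) ≠ 1) (x : Fin m → G) : autocorr ψ x = 0 := by
  have h (y : G) : ψ y * ∏ j, ψ (y + x j) = (ψ ^ (m + 1)) y * ∏ j, ψ (x j) := by
    simp only [AddChar.map_add_eq_mul, Finset.prod_mul_distrib, Finset.prod_const,
      Finset.card_univ, Fintype.card_fin, AddChar.pow_apply]
    ring
  simp only [autocorr, h, ← Finset.sum_mul, AddChar.sum_eq_zero_of_ne_one hψ, zero_mul]

/-- A finite abelian group has a complex character whose order is a multiple of its exponent. -/
lemma exists_addChar_exponent_dvd_orderOf (G : Type*) [AddCommGroup G] [Finite G] :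
    ∃ ψ : AddChar G ℂ, AddMonoid.exponent G ∣ orderOf ψ := by
  obtain ⟨ψ, hψ⟩ := Monoid.exists_orderOf_eq_exponent
    (Monoid.ExponentExists.of_finite (G := AddChar G ℂ))
  refine ⟨ψ, AddMonoid.exponent_dvd_of_forall_nsmul_eq_zero fun g => ?_⟩
  refine AddChar.forall_apply_eq_zero.1 fun φ => ?_
  rw [AddChar.map_nsmul_eq_pow, ← AddChar.pow_apply, hψ, Monoid.pow_exponent_eq_one,
    AddChar.one_apply]

theorem stmt12 {r : ℕ} (hr : 1 ≤ r) (a : Fin r → ℕ) [∀ i, NeZero (a i)]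
    (N : ℕ) (hN : N = AddMonoid.exponent (∀ i, ZMod (a i))) (hN2 : 2 ≤ N) :
    ∃ f : (∀ i, ZMod (a i)) → ℂ,
      (∃ x, f x ≠ 0) ∧
      (∀ m : ℕ, m + 1 ≤ N - 1 → ∀ x : Fin m → ∀ i, ZMod (a i), autocorr f x = 0) ∧
      (∀ m : ℕ, m + 1 ≤ N - 1 → ∀ x : Fin m → ∀ i, ZMod (a i),
        autocorr f x = autocorr (fun _ => (0 : ℂ)) x) ∧
      ¬ ∃ y, ∀ x, (0 : ℂ) = f (x + y) := by
  obtain ⟨ψ, hψ⟩ := exists_addChar_exponent_dvd_orderOf (∀ i, ZMod (a i))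
  have hzero (m : ℕ) (hm : m + 1 ≤ N - 1) (x : Fin m → ∀ i, ZMod (a i)) :
      autocorr ψ x = 0 := by
    refine autocorr_addChar_eq_zero ψ (fun h => ?_) x
    have := Nat.le_of_dvd m.succ_pos (hψ.trans (orderOf_dvd_of_pow_eq_one h))
    omega
  refine ⟨ψ, ⟨0, by simp⟩, hzero, fun m hm x => ?_, ?_⟩
  · rw [hzero m hm x]
    simp [autocorr]
  · rintro ⟨y, hy⟩
    have := hy (-y)
    simp at this
end

section
/- Assume the invariant factor form: each a_i ≥ 2 and a_i divides a_{i+1} for all i < r−1. Let d > 1 be a divisor of a_0 (hence d divides every a_i). Then there exist functions f, g : G → ℂ which have the same autocorrelations up to order (a_0 + a_1 + ⋯ + a_{r−1})/d but such that g is not a translation of f. -/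
open Complex Finset

/-- The linear combination of additive characters `ψ j` with coefficients `c j`. -/
noncomputable def charSum {G ι : Type*} [AddCommGroup G] [Fintype ι]
    (ψ : ι → AddChar G ℂ) (c : ι → ℂ) (y : G) : ℂ :=
  ∑ j, c j * ψ j y

theorem autocorr_charSum {G ι : Type*} [AddCommGroup G] [Fintype G] [Fintype ι]
    (ψ : ι → AddChar G ℂ) (c : ι → ℂ) {m : ℕ} (x : Fin m → G) :
    autocorr (charSum ψ c) x =
      ∑ J : Fin (m + 1) → ι, (∏ l, c (J l)) * (∏ l, ψ (J l) ((Fin.cons 0 x : Fin (m + 1) → G) l)) *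
        ∑ y, (∏ l, ψ (J l)) y := by
  have expand (y : G) : charSum ψ c y * ∏ j, charSum ψ c (y + x j) =
      ∏ l, charSum ψ c (y + (Fin.cons 0 x : Fin (m + 1) → G) l) := by
    simp [Fin.prod_univ_succ]
  simp only [autocorr, expand]
  simp only [charSum, Finset.prod_univ_sum, Fintype.piFinset_univ]
  rw [Finset.sum_comm]
  refine Finset.sum_congr rfl fun J _ => ?_
  rw [Finset.mul_sum]
  refine Finset.sum_congr rfl fun y _ => ?_
  rw [AddChar.prod_apply, ← Finset.prod_mul_distrib, ← Finset.prod_mul_distrib]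
  refine Finset.prod_congr rfl fun l _ => ?_
  rw [AddChar.map_add_eq_mul]
  ring

theorem autocorr_charSum_eq {G ι : Type*} [AddCommGroup G] [Fintype G] [Fintype ι]
    (ψ : ι → AddChar G ℂ) (c c' : ι → ℂ) {m : ℕ} (x : Fin m → G)
    (h : ∀ J : Fin (m + 1) → ι, ∏ l, ψ (J l) = 1 → ∏ l, c (J l) = ∏ l, c' (J l)) :
    autocorr (charSum ψ c) x = autocorr (charSum ψ c') x := by
  rw [autocorr_charSum, autocorr_charSum]
  refine Finset.sum_congr rfl fun J _ => ?_
  by_cases hJ : ∏ l, ψ (J l) = 1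
  · rw [h J hJ]
  · rw [AddChar.sum_eq_zero_of_ne_one hJ, mul_zero, mul_zero]

/-- If a sum of complex numbers of modulus at most one equals the number of summands,
every summand is one. -/
theorem eq_one_of_sum_eq_card {ι : Type*} [Fintype ι] {z : ι → ℂ} (hz : ∀ j, ‖z j‖ ≤ 1)
    (h : ∑ j, z j = Fintype.card ι) (j : ι) : z j = 1 := by
  have hre : ∀ j, (z j).re ≤ 1 := fun j => (Complex.re_le_norm _).trans (hz j)
  have hsum : ∑ j, (z j).re = ∑ _j : ι, (1 : ℝ) := by
    rw [← Complex.re_sum, h]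
    simp
  have hone : (z j).re = 1 :=
    (Finset.sum_eq_sum_iff_of_le fun j _ => hre j).1 hsum j (Finset.mem_univ j)
  have hsq : (z j).re * (z j).re + (z j).im * (z j).im ≤ 1 := by
    rw [← Complex.normSq_apply, Complex.normSq_eq_norm_sq]
    exact pow_le_one₀ (norm_nonneg _) (hz j)
  have him : (z j).im = 0 := by
    rw [hone] at hsq
    nlinarith [mul_self_nonneg (z j).im, sq_nonneg (z j).im]
  exact Complex.ext (by simpa using hone) (by simpa using him)

/-- The character of `∏ i, ZMod (a i)` attached to the vector `v`. -/
noncomputable def piChar {r : ℕ} (a : Fin r → ℕ) [∀ i, NeZero (a i)] (v : ∀ i, ZMod (a i)) :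
    AddChar (∀ i, ZMod (a i)) ℂ :=
  ∏ i, (AddChar.mulShift (ZMod.stdAddChar (N := a i)) (v i)).compAddMonoidHom
    (Pi.evalAddMonoidHom _ i)

theorem piChar_apply {r : ℕ} (a : Fin r → ℕ) [∀ i, NeZero (a i)] (v y : ∀ i, ZMod (a i)) :
    piChar a v y = ∏ i, ZMod.stdAddChar (v i * y i) := by
  simp [piChar, AddChar.prod_apply]

theorem piChar_single_right {r : ℕ} (a : Fin r → ℕ) [∀ i, NeZero (a i)] (v : ∀ i, ZMod (a i))
    (i : Fin r) : piChar a v (Pi.single i 1) = ZMod.stdAddChar (v i) := by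
  rw [piChar_apply, Finset.prod_eq_single i]
  · simp
  · intro j _ hj
    simp [Pi.single_eq_of_ne hj]
  · simp

theorem piChar_single_left {r : ℕ} (a : Fin r → ℕ) [∀ i, NeZero (a i)] (y : ∀ i, ZMod (a i))
    (i : Fin r) : piChar a (Pi.single i 1) y = ZMod.stdAddChar (y i) := by
  rw [piChar_apply, Finset.prod_eq_single i]
  · simp
  · intro j _ hj
    simp [Pi.single_eq_of_ne hj]
  · simp

theorem sum_eq_zero_of_prod_piChar_eq_one {r n : ℕ} (a : Fin r → ℕ) [∀ i, NeZero (a i)]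
    (v : Fin n → ∀ i, ZMod (a i)) (h : ∏ l, piChar a (v l) = 1) (i : Fin r) :
    ∑ l, v l i = 0 := by
  have h1 := DFunLike.congr_fun h (Pi.single i 1)
  simp only [AddChar.prod_apply, piChar_single_right, AddChar.one_apply] at h1
  apply ZMod.injective_stdAddChar
  have hsum := map_prod (ZMod.stdAddChar (N := a i)).toMonoidHom
    (fun l => Multiplicative.ofAdd (v l i)) univ
  rw [← ofAdd_sum] at hsum
  simp only [AddChar.toMonoidHom_apply, toAdd_ofAdd] at hsum
  rw [hsum, h1, AddChar.map_zero_eq_one]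

/-- The unit vectors of `∏ i, ZMod (a i)` together with the vector with entries `-(a i / d)`. -/
def frameVec {r : ℕ} (a : Fin r → ℕ) (d : ℕ) : Option (Fin r) → ∀ i, ZMod (a i)
  | some i => Pi.single i 1
  | none => fun i => -((a i / d : ℕ) : ZMod (a i))

theorem le_of_mul_div_modEq {a d n k : ℕ} (ha : 0 < a) (hd : d ∣ a) (hk : ¬ d ∣ k)
    (h : n ≡ k * (a / d) [MOD a]) : a / d ≤ n := by
  obtain ⟨q, rfl⟩ := hd
  have hd0 : 0 < d := Nat.pos_of_mul_pos_right ha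
  rw [Nat.mul_div_cancel_left q hd0] at h ⊢
  have hmod : n % (d * q) = k % d * q := by
    rw [h, Nat.mul_mod_mul_right]
  have hkd : 1 ≤ k % d := Nat.pos_of_ne_zero fun h0 => hk (Nat.dvd_of_mod_eq_zero h0)
  calc q ≤ k % d * q := Nat.le_mul_of_pos_left q hkd
    _ = n % (d * q) := hmod.symm
    _ ≤ n := Nat.mod_le _ _

theorem dvd_card_none_of_prod_eq_one {r n : ℕ} (a : Fin r → ℕ) [∀ i, NeZero (a i)] {d : ℕ}
    (hd : ∀ i, d ∣ a i) (hn : n ≤ ∑ i, a i / d) (J : Fin n → Option (Fin r))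
    (h : ∏ l, piChar a (frameVec a d (J l)) = 1) :
    d ∣ (univ.filter fun l => J l = none).card := by
  by_contra hk
  set k := (univ.filter fun l => J l = none).card
  have hle (i : Fin r) : a i / d ≤ (univ.filter fun l => J l = some i).card := by
    refine le_of_mul_div_modEq (NeZero.pos (a i)) (hd i) hk ?_
    rw [← ZMod.natCast_eq_natCast_iff, ← sub_eq_zero,
      ← sum_eq_zero_of_prod_piChar_eq_one a _ h i]
    have hval (l : Fin n) : frameVec a d (J l) i = (if J l = some i then 1 else 0) -
        (if J l = none then 1 else 0) * ((a i / d : ℕ) : ZMod (a i)) := by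
      rcases J l with _ | j
      · simp [frameVec]
      · rcases eq_or_ne i j with rfl | hij
        · simp [frameVec]
        · simp [frameVec, hij, hij.symm]
    simp only [hval, Finset.sum_sub_distrib, ← Finset.sum_mul, Finset.sum_boole]
    push_cast
    rfl
  have hcard : n = k + ∑ i, (univ.filter fun l => J l = some i).card := by
    have := Finset.card_eq_sum_card_fiberwise (f := J) (s := univ) (t := univ) (by simp)
    rwa [Finset.card_univ, Fintype.card_fin, Fintype.sum_option] at this
  have hsum := Finset.sum_le_sum fun i (_ : i ∈ univ) => hle i
  have hk0 : k ≠ 0 := fun h0 => hk (h0 ▸ dvd_zero d)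
  omega

/-- The coefficients equal to one on the unit vectors and to `ζ` on the extra vector. -/
def frameCoeff {r : ℕ} (ζ : ℂ) : Option (Fin r) → ℂ
  | some _ => 1
  | none => ζ

theorem prod_frameCoeff {r n : ℕ} (ζ : ℂ) (J : Fin n → Option (Fin r)) :
    ∏ l, frameCoeff ζ (J l) = ζ ^ (univ.filter fun l => J l = none).card := by
  have hval (l : Fin n) : frameCoeff ζ (J l) = if J l = none then ζ else 1 := by
    rcases J l with _ | j <;> simp [frameCoeff]
  simp [hval, Finset.prod_ite]

theorem not_translation_charSum {r : ℕ} (a : Fin r → ℕ) [∀ i, NeZero (a i)] (d : ℕ) {ζ : ℂ}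
    (hζ : ‖ζ‖ = 1) (hζ1 : ζ ≠ 1) :
    ¬ ∃ y, ∀ x, charSum (fun j => piChar a (frameVec a d j)) (frameCoeff ζ) x =
      charSum (fun j => piChar a (frameVec a d j)) 1 (x + y) := by
  rintro ⟨y, hy⟩
  have h := hy (-y)
  simp only [charSum, neg_add_cancel, AddChar.map_zero_eq_one, Pi.one_apply, mul_one,
    Finset.sum_const, Finset.card_univ, nsmul_eq_mul] at h
  have hone := eq_one_of_sum_eq_card (fun j => by
    rw [norm_mul, AddChar.norm_apply, mul_one]
    rcases j with _ | j <;> simp [frameCoeff, hζ]) h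
  have hy0 : -y = 0 := by
    funext i
    apply ZMod.injective_stdAddChar
    have := hone (some i)
    simp only [frameCoeff, frameVec, one_mul, piChar_single_left] at this
    rw [this, Pi.zero_apply, AddChar.map_zero_eq_one]
  have hnone := hone none
  rw [hy0, AddChar.map_zero_eq_one, mul_one] at hnone
  exact hζ1 hnone

theorem dvd_of_dvd_chain {r : ℕ} (hr : 1 ≤ r) (a : Fin r → ℕ)
    (hdvd : ∀ i : Fin r, ∀ h : (i : ℕ) + 1 < r, a i ∣ a ⟨(i : ℕ) + 1, h⟩)
    {d : ℕ} (hda : d ∣ a ⟨0, hr⟩) (i : Fin r) : d ∣ a i := by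
  obtain ⟨n, hn⟩ := i
  induction n with
  | zero => exact hda
  | succ n ih => exact (ih (Nat.lt_of_succ_lt hn)).trans (hdvd ⟨n, _⟩ hn)

theorem stmt13 {r : ℕ} (hr : 1 ≤ r) (a : Fin r → ℕ) [∀ i, NeZero (a i)]
    (ha2 : ∀ i, 2 ≤ a i)
    (hdvd : ∀ i : Fin r, ∀ h : (i : ℕ) + 1 < r, a i ∣ a ⟨(i : ℕ) + 1, h⟩)
    (d : ℕ) (hd1 : 1 < d) (hda : d ∣ a ⟨0, hr⟩) :
    ∃ f g : (∀ i, ZMod (a i)) → ℂ,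
      (∀ m : ℕ, m + 1 ≤ (∑ i, a i) / d → ∀ x : Fin m → ∀ i, ZMod (a i),
        autocorr f x = autocorr g x) ∧
      ¬ ∃ y, ∀ x, g x = f (x + y) := by
  have hd : ∀ i, d ∣ a i := dvd_of_dvd_chain hr a hdvd hda
  have hζ := Complex.isPrimitiveRoot_exp d (by omega)
  refine ⟨charSum (fun j => piChar a (frameVec a d j)) 1,
    charSum (fun j => piChar a (frameVec a d j)) (frameCoeff _), fun m hm x => ?_,
    not_translation_charSum a d (hζ.norm'_eq_one (by omega)) (hζ.ne_one hd1)⟩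
  refine (autocorr_charSum_eq _ _ _ x fun J hJ => ?_).symm
  rw [Nat.sum_div fun i _ => hd i] at hm
  rw [prod_frameCoeff, hζ.pow_eq_one_iff_dvd _ |>.2 (dvd_card_none_of_prod_eq_one a hd hm J hJ)]
  simp
end

section
/- For integers a, b define f_{a,b} : ℤ/6ℤ → ℂ by f_{a,b}(0) = 2a, f_{a,b}(1) = a−3b, f_{a,b}(2) = −a−3b, f_{a,b}(3) = −2a, f_{a,b}(4) = 3b−a, f_{a,b}(5) = a+3b. If a, b, a′, b′ are integers with a²+3b² = a′²+3b′², then f_{a,b} and f_{a′,b′} have the same autocorrelations up to order 5, i.e. M_n(f_{a,b}; x_1,…,x_{n−1}) = M_n(f_{a′,b′}; x_1,…,x_{n−1}) for all 1 ≤ n ≤ 5 and all x_1,…,x_{n−1} ∈ ℤ/6ℤ. -/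
open Complex Finset

/-- The function on `ℤ/6ℤ` with values `(2a, a−3b, −a−3b, −2a, 3b−a, a+3b)`. -/
noncomputable def fab (A B : ℤ) : ZMod 6 → ℂ := fun x =>
  if x = 0 then 2 * (A : ℂ)
  else if x = 1 then (A : ℂ) - 3 * (B : ℂ)
  else if x = 2 then -(A : ℂ) - 3 * (B : ℂ)
  else if x = 3 then -2 * (A : ℂ)
  else if x = 4 then 3 * (B : ℂ) - (A : ℂ)
  else (A : ℂ) + 3 * (B : ℂ)

/-- For a primitive additive character, mixed moments of `ψ y` and `ψ (-y)` vanish off the diagonal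
as long as the total order is below `N`. -/
lemma sum_pow_mul_pow_neg_eq_zero {N : ℕ} [NeZero N] {ψ : AddChar (ZMod N) ℂ}
    (hψ : ψ.IsPrimitive) {p q : ℕ} (hN : p + q < N) (hpq : p ≠ q) :
    ∑ y, ψ y ^ p * ψ (-y) ^ q = 0 := by
  have hne : ((p : ZMod N) - q) ≠ 0 := by
    rw [sub_ne_zero]
    intro hc
    rw [ZMod.natCast_eq_natCast_iff', Nat.mod_eq_of_lt (by lia), Nat.mod_eq_of_lt (by lia)] at hc
    exact hpq hc
  have hsum := AddChar.sum_mulShift ((p : ZMod N) - q) hψ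
  rw [if_neg hne, Nat.cast_zero] at hsum
  rw [← hsum]
  refine Finset.sum_congr rfl fun y _ => ?_
  rw [← AddChar.map_nsmul_eq_pow, ← AddChar.map_nsmul_eq_pow, ← AddChar.map_add_eq_mul]
  congr 1
  simp only [nsmul_eq_mul]
  ring

lemma sum_prod_add_char {N n : ℕ} [NeZero N] (ψ : AddChar (ZMod N) ℂ) (z w : ℂ)
    (x : Fin n → ZMod N) :
    ∑ y, ∏ j, (z * ψ (y + x j) + w * ψ (-(y + x j))) =
      ∑ t : Finset (Fin n), (z ^ #t * w ^ #tᶜ) *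
        ((∏ j ∈ t, ψ (x j)) * ∏ j ∈ tᶜ, ψ (-x j)) * ∑ y, ψ y ^ #t * ψ (-y) ^ #tᶜ := by
  simp only [Finset.prod_add, Finset.powerset_univ]
  rw [Finset.sum_comm]
  refine Finset.sum_congr rfl fun t _ => ?_
  rw [Finset.mul_sum]
  refine Finset.sum_congr rfl fun y _ => ?_
  simp only [neg_add, AddChar.map_add_eq_mul, Finset.prod_mul_distrib, Finset.prod_const,
    ← Finset.compl_eq_univ_sdiff]
  ring

/-- Low-order autocorrelations of `z ψ(y) + w ψ(-y)` depend only on the product `z w`. -/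
lemma autocorr_eq_of_mul_eq {N m : ℕ} [NeZero N] {ψ : AddChar (ZMod N) ℂ}
    (hψ : ψ.IsPrimitive) (hm : m + 1 < N) {z w z' w' : ℂ} (hzw : z * w = z' * w')
    (x : Fin m → ZMod N) :
    autocorr (fun y => z * ψ y + w * ψ (-y)) x = autocorr (fun y => z' * ψ y + w' * ψ (-y)) x := by
  have key (f : ZMod N → ℂ) :
      autocorr f x = ∑ y, ∏ j, f (y + (Fin.cons 0 x : Fin (m + 1) → ZMod N) j) := by
    simp [autocorr, Fin.prod_univ_succ]
  rw [key, key, sum_prod_add_char, sum_prod_add_char]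
  refine Finset.sum_congr rfl fun t _ => ?_
  by_cases ht : #t = #tᶜ
  · rw [← ht, ← mul_pow, ← mul_pow, hzw]
  · have hcard : #t + #tᶜ < N := by
      rw [Finset.card_add_card_compl, Fintype.card_fin]
      exact hm
    rw [sum_pow_mul_pow_neg_eq_zero hψ hcard ht, mul_zero, mul_zero]

lemma sqrt_three_mul_I_sq : (((√3 : ℝ) : ℂ) * I) ^ 2 = -3 := by
  rw [mul_pow, Complex.I_sq, ← Complex.ofReal_pow, Real.sq_sqrt (by norm_num)]
  norm_num

lemma stdAddChar_six_one : ZMod.stdAddChar (1 : ZMod 6) = (1 + (√3 : ℝ) * I) / 2 := by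
  have h := ZMod.stdAddChar_coe (N := 6) 1
  have harg : 2 * (Real.pi : ℂ) * I * ((1 : ℤ) : ℂ) / ((6 : ℕ) : ℂ) =
      ((Real.pi / 3 : ℝ) : ℂ) * I := by
    push_cast
    ring
  rw [harg, Complex.exp_mul_I, ← Complex.ofReal_cos, ← Complex.ofReal_sin,
    Real.cos_pi_div_three, Real.sin_pi_div_three] at h
  rw [← Int.cast_one, h]
  push_cast
  ring

lemma fab_eq_add_char (A B : ℤ) :
    fab A B = fun y => ((A : ℂ) + B * (√3 : ℝ) * I) * ZMod.stdAddChar y +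
      ((A : ℂ) - B * (√3 : ℝ) * I) * ZMod.stdAddChar (-y) := by
  have h1 := stdAddChar_six_one
  have h0 : ZMod.stdAddChar (0 : ZMod 6) = 1 := AddChar.map_zero_eq_one _
  have hsq := sqrt_three_mul_I_sq
  have h2 : ZMod.stdAddChar (2 : ZMod 6) = (-1 + (√3 : ℝ) * I) / 2 := by
    rw [show (2 : ZMod 6) = 1 + 1 by decide, AddChar.map_add_eq_mul, h1]
    linear_combination hsq / 4
  have h3 : ZMod.stdAddChar (3 : ZMod 6) = -1 := by
    rw [show (3 : ZMod 6) = 2 + 1 by decide, AddChar.map_add_eq_mul, h1, h2]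
    linear_combination hsq / 4
  have h4 : ZMod.stdAddChar (4 : ZMod 6) = (-1 - (√3 : ℝ) * I) / 2 := by
    rw [show (4 : ZMod 6) = 3 + 1 by decide, AddChar.map_add_eq_mul, h1, h3]
    ring
  have h5 : ZMod.stdAddChar (5 : ZMod 6) = (1 - (√3 : ℝ) * I) / 2 := by
    rw [show (5 : ZMod 6) = 3 + 2 by decide, AddChar.map_add_eq_mul, h2, h3]
    ring
  have hcases : ∀ y : ZMod 6, y = 0 ∨ y = 1 ∨ y = 2 ∨ y = 3 ∨ y = 4 ∨ y = 5 := by decide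
  funext y
  rcases hcases y with rfl | rfl | rfl | rfl | rfl | rfl
  · rw [neg_zero, h0, fab, if_pos rfl]
    ring
  · rw [show -(1 : ZMod 6) = 5 by decide, h1, h5, show fab A B 1 = A - 3 * B from rfl]
    linear_combination (-B : ℂ) * hsq
  · rw [show -(2 : ZMod 6) = 4 by decide, h2, h4, show fab A B 2 = -A - 3 * B from rfl]
    linear_combination (-B : ℂ) * hsq
  · rw [show -(3 : ZMod 6) = 3 by decide, h3, show fab A B 3 = -2 * A from rfl]
    ring
  · rw [show -(4 : ZMod 6) = 2 by decide, h2, h4, show fab A B 4 = 3 * B - A from rfl]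
    linear_combination (B : ℂ) * hsq
  · rw [show -(5 : ZMod 6) = 1 by decide, h1, h5, show fab A B 5 = A + 3 * B from rfl]
    linear_combination (B : ℂ) * hsq

theorem stmt14 (A B A' B' : ℤ) (h : A ^ 2 + 3 * B ^ 2 = A' ^ 2 + 3 * B' ^ 2) :
    ∀ m : ℕ, m + 1 ≤ 5 → ∀ x : Fin m → ZMod 6,
      autocorr (fab A B) x = autocorr (fab A' B') x := by
  intro m hm x
  have hC : (A : ℂ) ^ 2 + 3 * (B : ℂ) ^ 2 = (A' : ℂ) ^ 2 + 3 * (B' : ℂ) ^ 2 := by exact_mod_cast h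
  rw [fab_eq_add_char, fab_eq_add_char]
  refine autocorr_eq_of_mul_eq (ZMod.isPrimitive_stdAddChar 6) (by lia) ?_ x
  linear_combination hC + ((B' : ℂ) ^ 2 - (B : ℂ) ^ 2) * sqrt_three_mul_I_sq
end

section
/- Define f, g : ℤ/6ℤ → ℂ by f(0) = 14, f(1) = 7, f(2) = −7, f(3) = −14, f(4) = −7, f(5) = 7 and g(0) = 2, g(1) = −11, g(2) = −13, g(3) = −2, g(4) = 11, g(5) = 13. Then f and g have the same autocorrelations up to order 5, but g is not a translation of f (there is no y ∈ ℤ/6ℤ with g(x) = f(x+y) for all x). -/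
open Complex Finset

/-- The function `(14, 7, −7, −14, −7, 7)` on `ℤ/6ℤ`. -/
noncomputable def fEx : ZMod 6 → ℂ := fun x =>
  if x = 0 then 14 else if x = 1 then 7 else if x = 2 then -7
  else if x = 3 then -14 else if x = 4 then -7 else 7

/-- The function `(2, −11, −13, −2, 11, 13)` on `ℤ/6ℤ`. -/
noncomputable def gEx : ZMod 6 → ℂ := fun x =>
  if x = 0 then 2 else if x = 1 then -11 else if x = 2 then -13
  else if x = 3 then -2 else if x = 4 then 11 else 13

theorem autocorr_eq_zero_of_antiperiodic {G : Type*} [AddCommGroup G] [Fintype G] {f : G → ℂ}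
    {c : G} (hf : Function.Antiperiodic f c) {m : ℕ} (hm : Even m) (x : Fin m → G) :
    autocorr f x = 0 := by
  have h : autocorr f x = -autocorr f x := by
    conv_lhs => rw [autocorr, ← Equiv.sum_comp (Equiv.addRight c)]
    rw [autocorr, ← Finset.sum_neg_distrib]
    refine Finset.sum_congr rfl fun y _ => ?_
    have hx (j : Fin m) : f (y + c + x j) = -f (y + x j) := by
      rw [add_right_comm]
      exact hf _
    simp [hx, hf y, Finset.prod_neg, hm.neg_one_pow]
  exact self_eq_neg.mp h

/-- The integer values of `fEx`. -/
def fExInt : ZMod 6 → ℤ := fun x =>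
  if x = 0 then 14 else if x = 1 then 7 else if x = 2 then -7
  else if x = 3 then -14 else if x = 4 then -7 else 7

/-- The integer values of `gEx`. -/
def gExInt : ZMod 6 → ℤ := fun x =>
  if x = 0 then 2 else if x = 1 then -11 else if x = 2 then -13
  else if x = 3 then -2 else if x = 4 then 11 else 13

theorem fEx_eq_intCast (x : ZMod 6) : fEx x = fExInt x := by
  unfold fEx fExInt
  push_cast
  rfl

theorem gEx_eq_intCast (x : ZMod 6) : gEx x = gExInt x := by
  unfold gEx gExInt
  push_cast
  rfl

theorem fEx_antiperiodic : Function.Antiperiodic fEx 3 := by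
  intro x
  have h : ∀ x, fExInt (x + 3) = -fExInt x := by decide
  rw [fEx_eq_intCast, fEx_eq_intCast, h, Int.cast_neg]

theorem gEx_antiperiodic : Function.Antiperiodic gEx 3 := by
  intro x
  have h : ∀ x, gExInt (x + 3) = -gExInt x := by decide
  rw [gEx_eq_intCast, gEx_eq_intCast, h, Int.cast_neg]

theorem sum_fExInt_two (a : ZMod 6) :
    ∑ y, fExInt y * fExInt (y + a) = ∑ y, gExInt y * gExInt (y + a) := by
  revert a
  decide +kernel

theorem sum_fExInt_four (a b c : ZMod 6) :
    ∑ y, fExInt y * (fExInt (y + a) * fExInt (y + b) * fExInt (y + c)) =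
      ∑ y, gExInt y * (gExInt (y + a) * gExInt (y + b) * gExInt (y + c)) := by
  revert a b c
  decide +kernel

theorem stmt15 :
    (∀ m : ℕ, m + 1 ≤ 5 → ∀ x : Fin m → ZMod 6, autocorr fEx x = autocorr gEx x) ∧
    ¬ ∃ y : ZMod 6, ∀ x, gEx x = fEx (x + y) := by
  refine ⟨fun m hm x => ?_, ?_⟩
  · rcases Nat.even_or_odd m with he | ho
    · rw [autocorr_eq_zero_of_antiperiodic fEx_antiperiodic he,
        autocorr_eq_zero_of_antiperiodic gEx_antiperiodic he]
    · obtain rfl | rfl : m = 1 ∨ m = 3 := by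
        obtain ⟨k, rfl⟩ := ho
        omega
      · simp only [autocorr, Fin.prod_univ_one, fEx_eq_intCast, gEx_eq_intCast]
        exact_mod_cast sum_fExInt_two (x 0)
      · simp only [autocorr, Fin.prod_univ_three, fEx_eq_intCast, gEx_eq_intCast]
        exact_mod_cast sum_fExInt_four (x 0) (x 1) (x 2)
  · rintro ⟨y, hy⟩
    have h0 := hy 0
    rw [fEx_eq_intCast, gEx_eq_intCast, Int.cast_inj, zero_add] at h0
    have h : ∀ y, gExInt 0 ≠ fExInt y := by decide
    exact h y h0
end

section
/- For every integer r ≥ 1 there exist rational-valued functions f, g : (ℤ/6ℤ)^r → ℂ which have the same autocorrelations up to order 3r but such that g is not a translation of f. -/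
open Complex Finset

/-- The function `t ↦ 2 cos (π t / 3)` on `ℤ/6ℤ`. -/
def hexCos : ZMod 6 → ℤ := ![2, 1, -1, -2, -1, 1]

/-- The quadratic character `t ↦ (-1)^t` on `ℤ/6ℤ`. -/
def hexSign : ZMod 6 → ℤ := ![1, -1, 1, -1, 1, -1]

theorem hexSign_add (a b : ZMod 6) : hexSign (a + b) = hexSign a * hexSign b := by
  revert a b; decide

theorem hexSign_sq (a : ZMod 6) : hexSign a ^ 2 = 1 := by
  revert a; decide

theorem hexCos_le (a : ZMod 6) : hexCos a ≤ 2 := by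
  revert a; decide

theorem eq_zero_of_hexCos_eq (a : ZMod 6) : hexCos a = 2 → a = 0 := by
  revert a; decide

theorem hexCos_add_shifts (a : ZMod 6) : hexCos a + hexCos (2 + a) + hexCos (4 + a) = 0 := by
  revert a; decide

/-- `hexSign` is orthogonal to products of fewer than three translates of `hexCos`. -/
theorem sum_hexSign_mul_prod_hexCos {ι : Type*} (s : Finset ι) (hs : s.card < 3)
    (a : ι → ZMod 6) : ∑ t, hexSign t * ∏ j ∈ s, hexCos (t + a j) = 0 := by
  classical
  have h0 : ∑ t, hexSign t = 0 := by decide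
  have h1 : ∀ a, ∑ t, hexSign t * hexCos (t + a) = 0 := by decide
  have h2 : ∀ a b, ∑ t, hexSign t * (hexCos (t + a) * hexCos (t + b)) = 0 := by decide
  obtain h | h | h : s.card = 0 ∨ s.card = 1 ∨ s.card = 2 := by omega
  · rw [Finset.card_eq_zero] at h
    simpa [h] using h0
  · obtain ⟨i, rfl⟩ := Finset.card_eq_one.1 h
    simpa using h1 (a i)
  · obtain ⟨i, j, hij, rfl⟩ := Finset.card_eq_two.1 h
    simpa [Finset.prod_pair hij] using h2 (a i) (a j)

/-- The sum of `hexCos` over all coordinates. -/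
def cosSum {r : ℕ} (x : Fin r → ZMod 6) : ℤ := ∑ i, hexCos (x i)

/-- The character `x ↦ (-1)^(x_1 + ⋯ + x_r)`. -/
def prodSign {r : ℕ} (x : Fin r → ZMod 6) : ℤ := ∏ i, hexSign (x i)

theorem prodSign_add {r : ℕ} (x y : Fin r → ZMod 6) :
    prodSign (x + y) = prodSign x * prodSign y := by
  simp [prodSign, hexSign_add, Finset.prod_mul_distrib]

theorem prodSign_sq {r : ℕ} (x : Fin r → ZMod 6) : prodSign x ^ 2 = 1 := by
  simp [prodSign, ← Finset.prod_pow, hexSign_sq]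

/-- `prodSign` is orthogonal to products of fewer than `3 * r` translates of `cosSum`. -/
theorem sum_prodSign_mul_prod_cosSum {r : ℕ} {ι : Type*} [Fintype ι]
    (hι : Fintype.card ι < 3 * r) (x : ι → Fin r → ZMod 6) :
    ∑ y, prodSign y * ∏ j, cosSum (y + x j) = 0 := by
  classical
  simp only [cosSum, Finset.prod_univ_sum, Finset.mul_sum]
  rw [Finset.sum_comm]
  refine Finset.sum_eq_zero fun p _ => ?_
  obtain ⟨i, hi⟩ : ∃ i, (univ.filter fun j => p j = i).card < 3 := by
    by_contra! h
    have hsum := Finset.card_eq_sum_card_fiberwise (f := p) (s := univ) (t := univ)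
      fun _ _ => by simp
    have hle := Finset.sum_le_sum fun i (_ : i ∈ (univ : Finset (Fin r))) => h i
    simp only [Finset.sum_const, Finset.card_univ, Fintype.card_fin, smul_eq_mul] at hle hsum
    omega
  have hfactor : ∀ y : Fin r → ZMod 6,
      prodSign y * ∏ j, hexCos ((y + x j) (p j)) =
        ∏ i, (hexSign (y i) * ∏ j with p j = i, hexCos (y i + x j i)) := by
    intro y
    rw [Finset.prod_mul_distrib, prodSign, ← Finset.prod_fiberwise univ p]
    congr 1
    refine Finset.prod_congr rfl fun i _ => Finset.prod_congr rfl fun j hj => ?_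
    rw [← (Finset.mem_filter.1 hj).2, Pi.add_apply]
  simp only [hfactor]
  rw [← Fintype.piFinset_univ, ← Finset.prod_univ_sum (fun _ => univ)
    fun i t => hexSign t * ∏ j with p j = i, hexCos (t + x j i)]
  exact Finset.prod_eq_zero (Finset.mem_univ i)
    (sum_hexSign_mul_prod_hexCos _ hi fun j => x j i)

theorem sum_prod_cosSum_add_prodSign {r : ℕ} {ι : Type*} [Fintype ι]
    (hι : Fintype.card ι ≤ 3 * r) (x : ι → Fin r → ZMod 6) :
    ∑ y, ∏ j, (cosSum (y + x j) + prodSign (y + x j)) =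
      ∑ y, ∏ j, (cosSum (y + x j) + -prodSign (y + x j)) := by
  classical
  simp only [Finset.prod_add]
  rw [Finset.sum_comm, Finset.sum_comm (s := univ)]
  refine Finset.sum_congr rfl fun t _ => ?_
  simp only [Finset.prod_neg]
  rcases Nat.even_or_odd (univ \ t).card with he | ho
  · simp [he.neg_one_pow]
  · have hzero : ∑ y, (∏ j ∈ t, cosSum (y + x j)) * ∏ j ∈ univ \ t, prodSign (y + x j) = 0 := by
      have hpow : ∀ y : Fin r → ZMod 6, prodSign y ^ (univ \ t).card = prodSign y := by
        intro y
        obtain ⟨k, hk⟩ := ho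
        rw [hk, pow_succ, pow_mul, prodSign_sq, one_pow, one_mul]
      have hcard : Fintype.card t < 3 * r := by
        have := Finset.card_sdiff_add_card_eq_card (Finset.subset_univ t)
        have := ho.pos
        rw [Fintype.card_coe]
        rw [Finset.card_univ] at *
        omega
      have h := sum_prodSign_mul_prod_cosSum hcard fun j => x j
      calc _ = ∑ y, (∏ j ∈ univ \ t, prodSign (x j)) *
              (prodSign y * ∏ j : t, cosSum (y + x j)) := by
            refine Finset.sum_congr rfl fun y _ => ?_
            simp only [prodSign_add, Finset.prod_mul_distrib, Finset.prod_const, hpow]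
            rw [Finset.prod_coe_sort t fun j => cosSum (y + x j)]
            ring
        _ = 0 := by rw [← Finset.mul_sum, h, mul_zero]
    simp only [ho.neg_one_pow, neg_mul, one_mul, mul_neg, Finset.sum_neg_distrib, hzero, neg_zero]

theorem autocorr_intCast {G : Type*} [AddCommGroup G] [Fintype G] (f : G → ℤ) {m : ℕ}
    (x : Fin m → G) :
    autocorr (fun y => (f y : ℂ)) x =
      ((∑ y, ∏ j, f (y + (Fin.cons 0 x : Fin (m + 1) → G) j) : ℤ) : ℂ) := by
  simp [autocorr, Fin.prod_univ_succ]

theorem not_translate_cosSum_add_prodSign {r : ℕ} (y : Fin r → ZMod 6) :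
    ¬ ∀ x, cosSum x + -prodSign x = cosSum (x + y) + prodSign (x + y) := by
  intro h
  have hsign : ∀ a : ZMod 6, hexSign a = 1 → prodSign (fun _ : Fin r => a) = 1 := by
    intro a ha
    simp [prodSign, ha]
  have e0 := h 0
  have e2 := h fun _ => 2
  have e4 := h fun _ => 4
  have s0 : prodSign (0 : Fin r → ZMod 6) = 1 := hsign 0 (by decide)
  rw [prodSign_add, s0, zero_add] at e0
  rw [prodSign_add, hsign 2 (by decide)] at e2
  rw [prodSign_add, hsign 4 (by decide)] at e4
  have shifts : ∀ z : Fin r → ZMod 6,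
      cosSum z + cosSum ((fun _ => 2) + z) + cosSum ((fun _ => 4) + z) = 0 := by
    intro z
    simp only [cosSum, ← Finset.sum_add_distrib]
    exact Finset.sum_eq_zero fun i _ => hexCos_add_shifts (z i)
  have hy := shifts y
  have hz := shifts 0
  rw [add_zero, add_zero] at hz
  have hneg : prodSign y = -1 := by linarith
  have hcos : cosSum y = cosSum (0 : Fin r → ZMod 6) := by linarith
  have hall := (Finset.sum_eq_sum_iff_of_le fun i _ => hexCos_le (y i)).1 hcos
  have hy0 : y = 0 := funext fun i => eq_zero_of_hexCos_eq _ (hall i (Finset.mem_univ i))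
  rw [hy0, s0] at hneg
  norm_num at hneg

theorem stmt16 (r : ℕ) (hr : 1 ≤ r) :
    ∃ f g : (Fin r → ZMod 6) → ℂ,
      (∀ x, ∃ q : ℚ, f x = (q : ℂ)) ∧
      (∀ x, ∃ q : ℚ, g x = (q : ℂ)) ∧
      (∀ m : ℕ, m + 1 ≤ 3 * r → ∀ x : Fin m → (Fin r → ZMod 6),
        autocorr f x = autocorr g x) ∧
      ¬ ∃ y : Fin r → ZMod 6, ∀ x, g x = f (x + y) := by
  refine ⟨fun x => ((cosSum x + prodSign x : ℤ) : ℂ), fun x => ((cosSum x + -prodSign x : ℤ) : ℂ),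
    fun x => ⟨(cosSum x + prodSign x : ℤ), by push_cast; rfl⟩,
    fun x => ⟨(cosSum x + -prodSign x : ℤ), by push_cast; rfl⟩, fun m hm x => ?_, ?_⟩
  · rw [autocorr_intCast fun y => cosSum y + prodSign y,
      autocorr_intCast fun y => cosSum y + -prodSign y,
      sum_prod_cosSum_add_prodSign (by simpa using hm)]
  · rintro ⟨y, h⟩
    exact not_translate_cosSum_add_prodSign y fun x => Int.cast_injective (h x)
end

section
/- For all distinct odd primes p and q and every integer r ≥ 1, there exist rational-valued functions f, g : (ℤ/2pqℤ)^r → ℂ which have the same autocorrelations up to order 3r+2 but such that g is not a translation of f. -/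
open Complex Finset

/-- If every function in a finite family except `F (φ k)` is invariant under the shifts `w t`, and the
shifts of `F (φ k)` sum to zero, then the mixed correlation of the family vanishes. -/
theorem sum_prod_eq_zero_of_sum_shift_eq_zero {G κ ι : Type*} [AddCommGroup G] [Fintype G]
    [Fintype κ] [Nonempty κ] {n : ℕ} (F : ι → G → ℤ) (φ : Fin n → ι) (z : Fin n → G)
    (k : Fin n) (w : κ → G) (hk : ∀ y, ∑ t, F (φ k) (y + w t) = 0)
    (hinv : ∀ j, j ≠ k → ∀ y t, F (φ j) (y + w t) = F (φ j) y) :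
    ∑ y, ∏ j, F (φ j) (y + z j) = 0 := by
  have hshift : ∀ t, ∑ y, ∏ j, F (φ j) (y + w t + z j) = ∑ y, ∏ j, F (φ j) (y + z j) := fun t ↦
    Equiv.sum_comp (Equiv.addRight (w t)) fun y ↦ ∏ j, F (φ j) (y + z j)
  have hsum : ∑ t, ∑ y, ∏ j, F (φ j) (y + w t + z j) = 0 := by
    rw [sum_comm]
    refine sum_eq_zero fun y _ ↦ ?_
    have hfac : ∀ t, ∏ j, F (φ j) (y + w t + z j) =
        F (φ k) (y + z k + w t) * ∏ j ∈ univ.erase k, F (φ j) (y + z j) := fun t ↦ by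
      rw [← mul_prod_erase univ _ (mem_univ k), add_right_comm]
      congr 1
      refine prod_congr rfl fun j hj ↦ ?_
      rw [add_right_comm, hinv j (ne_of_mem_erase hj)]
    rw [sum_congr rfl fun t _ ↦ hfac t, ← sum_mul, hk, zero_mul]
  rw [sum_congr rfl fun t _ ↦ hshift t, sum_const, nsmul_eq_mul] at hsum
  exact (mul_eq_zero.mp hsum).resolve_left (by simp)

/-- If a shift multiplies each function of a finite family by a constant, and the product of these
constants is `-1`, then the mixed correlation of the family vanishes. -/
theorem sum_prod_eq_zero_of_shift_eq_neg {G ι : Type*} [AddCommGroup G] [Fintype G]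
    {n : ℕ} (F : ι → G → ℤ) (φ : Fin n → ι) (z : Fin n → G) (u : G) (e : ι → ℤ)
    (he : ∀ c y, F c (y + u) = e c * F c y) (hprod : ∏ j, e (φ j) = -1) :
    ∑ y, ∏ j, F (φ j) (y + z j) = 0 := by
  have hshift : ∑ y, ∏ j, F (φ j) (y + u + z j) = ∑ y, ∏ j, F (φ j) (y + z j) :=
    Equiv.sum_comp (Equiv.addRight u) fun y ↦ ∏ j, F (φ j) (y + z j)
  simp only [add_right_comm _ u, he, prod_mul_distrib, hprod, ← mul_sum] at hshift
  lia

/-- A family of functions indexed by `Option (Fin r)` such that some shift negates exactly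
`F none` and `F (some i)`, for each `i`, and such that each `F c` averages to zero along shifts
that leave the other members of the family invariant. -/
structure IsSeparatedFamily {G : Type*} [AddCommGroup G] {r : ℕ}
    (F : Option (Fin r) → G → ℤ) : Prop where
  exists_neg : ∀ i, ∃ u : G, ∀ c y,
    F c (y + u) = (if c = none then -1 else 1) * (if c = some i then -1 else 1) * F c y
  exists_avg : ∀ c, ∃ (m : ℕ) (w : Fin (m + 1) → G), (∀ y, ∑ t, F c (y + w t) = 0) ∧
    ∀ c', c' ≠ c → ∀ y t, F c' (y + w t) = F c' y

namespace IsSeparatedFamily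

variable {G : Type*} [AddCommGroup G] [Fintype G] {r : ℕ} {F : Option (Fin r) → G → ℤ}

theorem sum_prod_eq_zero (hF : IsSeparatedFamily F) {n : ℕ} (hn : n ≤ 3 * r + 2)
    (φ : Fin n → Option (Fin r)) (z : Fin n → G) (hodd : Odd #{j | φ j = none}) :
    ∑ y, ∏ j, F (φ j) (y + z j) = 0 := by
  by_cases hall : ∀ i, Odd #{j | φ j = some i}
  · obtain ⟨c, hc⟩ : ∃ c, #{j | φ j = c} = 1 := by
      by_contra! hne
      have hge : ∀ c, 3 ≤ #{j | φ j = c} := fun c ↦ by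
        have hc : Odd #{j | φ j = c} := by cases c with
          | none => exact hodd
          | some i => exact hall i
        have := hne c
        obtain ⟨l, hl⟩ := hc
        lia
      have hcard := card_eq_sum_card_fiberwise (f := φ) (s := univ) (t := univ) (by simp)
      have hle := sum_le_sum fun c (_ : c ∈ (univ : Finset (Option (Fin r)))) ↦ hge c
      rw [← hcard] at hle
      simp at hle
      lia
    obtain ⟨k, hk⟩ := card_eq_one.mp hc
    have hmem : ∀ j, φ j = c ↔ j = k := fun j ↦ by simpa using congrArg (j ∈ ·) hk
    obtain ⟨m, w, hw, hinv⟩ := hF.exists_avg c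
    have hkc : φ k = c := (hmem k).mpr rfl
    exact sum_prod_eq_zero_of_sum_shift_eq_zero F φ z k w (hkc ▸ hw)
      fun j hj ↦ hinv _ (mt (hmem j).mp hj)
  · push Not at hall
    obtain ⟨i, hi⟩ := hall
    obtain ⟨u, hu⟩ := hF.exists_neg i
    refine sum_prod_eq_zero_of_shift_eq_neg F φ z u _ hu ?_
    rw [prod_mul_distrib, prod_ite, prod_ite]
    simp [hodd.neg_one_pow, (Nat.not_odd_iff_even.mp hi).neg_one_pow]

theorem sum_prod_sum_eq (hF : IsSeparatedFamily F) {n : ℕ} (hn : n ≤ 3 * r + 2)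
    (z : Fin n → G) :
    ∑ y, ∏ j, ∑ c, F c (y + z j) =
      ∑ y, ∏ j, ∑ c, (if c = none then -1 else 1) * F c (y + z j) := by
  simp only [prod_univ_sum, Fintype.piFinset_univ]
  rw [sum_comm, sum_comm (s := (univ : Finset G))]
  refine sum_congr rfl fun φ _ ↦ ?_
  simp only [prod_mul_distrib, ← mul_sum]
  rcases Nat.even_or_odd #{j | φ j = none} with h | h
  · rw [prod_ite]
    simp [h.neg_one_pow]
  · rw [hF.sum_prod_eq_zero hn φ z h, mul_zero]

theorem autocorr_eq (hF : IsSeparatedFamily F) {m : ℕ} (hm : m + 1 ≤ 3 * r + 2)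
    (x : Fin m → G) :
    autocorr (fun y ↦ ((∑ c, F c y : ℤ) : ℂ)) x =
      autocorr (fun y ↦ ((∑ c, (if c = none then -1 else 1) * F c y : ℤ) : ℂ)) x := by
  have h := congrArg (Int.cast : ℤ → ℂ) (hF.sum_prod_sum_eq hm (Fin.cons 0 x))
  simp only [Fin.prod_univ_succ, Fin.cons_zero, Fin.cons_succ, add_zero] at h
  simp only [autocorr]
  exact_mod_cast h

end IsSeparatedFamily

/-- The nontrivial character of `ZMod 2`. -/
def paritySign (a : ZMod 2) : ℤ := if a = 0 then 1 else -1

theorem paritySign_add_one (a : ZMod 2) : paritySign (a + 1) = -paritySign a := by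
  revert a; decide

/-- The sum of the nontrivial characters of `ZMod n`. -/
def ramanujanSum (n : ℕ) (a : ZMod n) : ℤ := (if a = 0 then (n : ℤ) else 0) - 1

theorem sum_ramanujanSum (n : ℕ) [NeZero n] (a b : ZMod n) (hb : IsUnit b) :
    ∑ t : Fin n, ramanujanSum n (a + b * ((t : ℕ) : ZMod n)) = 0 := by
  have hbij : Function.Bijective fun t : Fin n ↦ a + b * ((t : ℕ) : ZMod n) := by
    rw [Fintype.bijective_iff_injective_and_card]
    refine ⟨fun s t h ↦ Fin.ext ?_, by simp [ZMod.card]⟩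
    have h' := hb.mul_left_cancel (add_left_cancel h)
    rwa [ZMod.natCast_eq_natCast_iff', Nat.mod_eq_of_lt s.2, Nat.mod_eq_of_lt t.2] at h'
  rw [Function.Bijective.sum_comp hbij (ramanujanSum n)]
  simp [ramanujanSum, ZMod.card]

section

variable {p q r : ℕ}

/-- Reduction of `ZMod N` modulo a divisor `d` of `N`. -/
def reduce {N : ℕ} (d : ℕ) (h : d ∣ N) : ZMod N →+* ZMod d := ZMod.castHom h (ZMod d)

/-- Sums of characters of `(ZMod (2 * p * q))^r`: the component `some i` involves the characters of
order `2 * p` of the `i`-th coordinate, and the component `none` the products of the quadratic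
characters of all coordinates with the characters of order `q` of the coordinate `i₀`. -/
def component (p q : ℕ) (i₀ : Fin r) :
    Option (Fin r) → (Fin r → ZMod (2 * p * q)) → ℤ
  | none, x => (∏ j, paritySign (reduce 2 ⟨p * q, by ring⟩ (x j))) *
      ramanujanSum q (reduce q ⟨2 * p, by ring⟩ (x i₀))
  | some i, x => paritySign (reduce 2 ⟨p * q, by ring⟩ (x i)) *
      ramanujanSum p (reduce p ⟨2 * q, by ring⟩ (x i))

theorem prod_paritySign_add_single {N : ℕ} (h2 : 2 ∣ N) (y : Fin r → ZMod N) (i : Fin r)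
    (a : ℕ) :
    ∏ j, paritySign (reduce 2 h2 ((y + Pi.single i (a : ZMod N) : Fin r → ZMod N) j)) =
      paritySign (reduce 2 h2 (y i) + a) * ∏ j ∈ univ.erase i, paritySign (reduce 2 h2 (y j)) := by
  rw [← mul_prod_erase univ _ (mem_univ i)]
  congr 1
  · simp
  · refine prod_congr rfl fun j hj ↦ ?_
    simp [Pi.single_eq_of_ne (ne_of_mem_erase hj)]

theorem component_none_add_single (i₀ i : Fin r) (y : Fin r → ZMod (2 * p * q)) (a : ℕ)
    (ha : (a : ZMod q) = 0) :
    component p q i₀ none (y + Pi.single i (a : ZMod (2 * p * q))) =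
      paritySign (reduce 2 ⟨p * q, by ring⟩ (y i) + a) *
        (∏ j ∈ univ.erase i, paritySign (reduce 2 ⟨p * q, by ring⟩ (y j))) *
        ramanujanSum q (reduce q ⟨2 * p, by ring⟩ (y i₀)) := by
  rw [component, prod_paritySign_add_single]
  congr 2
  rcases eq_or_ne i₀ i with rfl | h
  · simp [ha]
  · simp [Pi.single_eq_of_ne h]

theorem component_some_add_single_of_ne (i₀ : Fin r) {i j : Fin r} (hij : j ≠ i)
    (y : Fin r → ZMod (2 * p * q)) (a : ZMod (2 * p * q)) :
    component p q i₀ (some j) (y + Pi.single i a) = component p q i₀ (some j) y := by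
  simp [component, Pi.single_eq_of_ne hij]

theorem component_none_eq (i₀ i : Fin r) (y : Fin r → ZMod (2 * p * q)) :
    component p q i₀ none y =
      paritySign (reduce 2 ⟨p * q, by ring⟩ (y i)) *
        (∏ j ∈ univ.erase i, paritySign (reduce 2 ⟨p * q, by ring⟩ (y j))) *
        ramanujanSum q (reduce q ⟨2 * p, by ring⟩ (y i₀)) := by
  rw [component, mul_prod_erase univ (fun j ↦ paritySign (reduce 2 _ (y j))) (mem_univ i)]

theorem component_neg (hp : Odd p) (hq : Odd q) (i₀ i : Fin r) (c : Option (Fin r))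
    (y : Fin r → ZMod (2 * p * q)) :
    component p q i₀ c (y + Pi.single i ((p * q : ℕ) : ZMod (2 * p * q))) =
      (if c = none then -1 else 1) * (if c = some i then -1 else 1) * component p q i₀ c y := by
  have h2 : ((p * q : ℕ) : ZMod 2) = 1 := ZMod.natCast_eq_one_iff_odd.mpr (hp.mul hq)
  cases c with
  | none =>
    rw [component_none_add_single i₀ i y _ (by simp), h2, paritySign_add_one,
      component_none_eq i₀ i]
    simp
  | some j =>
    rcases eq_or_ne j i with rfl | h
    · have h' : (p : ZMod 2) * q = 1 := by exact_mod_cast h2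
      simp [component, h', paritySign_add_one]
    · rw [component_some_add_single_of_ne i₀ h]
      simp [h]

theorem isUnit_two_mul_natCast (hp : p.Prime) (hq : q.Prime) (hpodd : Odd p) (hpq : p ≠ q) :
    IsUnit ((2 * q : ℕ) : ZMod p) := by
  rw [ZMod.isUnit_iff_coprime]
  exact Nat.Coprime.mul_left hpodd.coprime_two_left ((Nat.coprime_primes hq hp).mpr hpq.symm)

theorem sum_component_some (hp : p.Prime) (hq : q.Prime) (hpodd : Odd p) (hpq : p ≠ q)
    (i₀ i : Fin r) (y : Fin r → ZMod (2 * p * q)) :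
    ∑ t : Fin p, component p q i₀ (some i)
      (y + Pi.single i ((2 * q * t : ℕ) : ZMod (2 * p * q))) = 0 := by
  have : NeZero p := ⟨hp.ne_zero⟩
  have h2 : (2 : ZMod 2) = 0 := rfl
  have h := sum_ramanujanSum p (reduce p ⟨2 * q, by ring⟩ (y i)) _
    (isUnit_two_mul_natCast hp hq hpodd hpq)
  push_cast at h
  simp [component, h2, map_ofNat, ← mul_sum, h]

theorem component_avg_some (i₀ i : Fin r) (c : Option (Fin r)) (hc : c ≠ some i)
    (y : Fin r → ZMod (2 * p * q)) (t : ℕ) :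
    component p q i₀ c (y + Pi.single i ((2 * q * t : ℕ) : ZMod (2 * p * q))) =
      component p q i₀ c y := by
  have h2 : (2 : ZMod 2) = 0 := rfl
  cases c with
  | none =>
    rw [component_none_add_single i₀ i y _ (by simp), component_none_eq i₀ i]
    simp [h2]
  | some j => exact component_some_add_single_of_ne i₀ (by simpa using hc) _ _

theorem sum_component_none (hp : p.Prime) (hq : q.Prime) (hqodd : Odd q) (hpq : p ≠ q)
    (i₀ : Fin r) (y : Fin r → ZMod (2 * p * q)) :
    ∑ t : Fin q, component p q i₀ none
      (y + Pi.single i₀ ((2 * p * t : ℕ) : ZMod (2 * p * q))) = 0 := by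
  have : NeZero q := ⟨hq.ne_zero⟩
  have h2 : (2 : ZMod 2) = 0 := rfl
  have h := sum_ramanujanSum q (reduce q ⟨2 * p, by ring⟩ (y i₀)) _
    (isUnit_two_mul_natCast hq hp hqodd hpq.symm)
  push_cast at h
  simp only [component, prod_paritySign_add_single]
  simp [h2, map_ofNat, ← mul_sum, h]

theorem component_avg_none (i₀ i : Fin r) (y : Fin r → ZMod (2 * p * q)) (t : ℕ) :
    component p q i₀ (some i) (y + Pi.single i₀ ((2 * p * t : ℕ) : ZMod (2 * p * q))) =
      component p q i₀ (some i) y := by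
  have h2 : (2 : ZMod 2) = 0 := rfl
  rcases eq_or_ne i i₀ with rfl | h
  · simp [component, h2, map_ofNat]
  · exact component_some_add_single_of_ne i₀ h _ _

theorem isSeparatedFamily_component (hp : p.Prime) (hq : q.Prime) (hpodd : Odd p)
    (hqodd : Odd q) (hpq : p ≠ q) (i₀ : Fin r) : IsSeparatedFamily (component p q i₀) where
  exists_neg i := ⟨_, component_neg hpodd hqodd i₀ i⟩
  exists_avg c := by
    cases c with
    | none =>
      obtain ⟨m, hm⟩ := Nat.exists_eq_succ_of_ne_zero hq.ne_zero
      refine ⟨m, fun t ↦ Pi.single i₀ ((2 * p * t : ℕ) : ZMod (2 * p * q)), fun y ↦ ?_, ?_⟩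
      · rw [← sum_component_none hp hq hqodd hpq i₀ y]
        exact Fintype.sum_equiv (finCongr hm.symm) _ _ fun _ ↦ rfl
      · rintro (_ | i) hc y t
        · exact absurd rfl hc
        · exact component_avg_none i₀ i y t
    | some i =>
      obtain ⟨m, hm⟩ := Nat.exists_eq_succ_of_ne_zero hp.ne_zero
      refine ⟨m, fun t ↦ Pi.single i ((2 * q * t : ℕ) : ZMod (2 * p * q)), fun y ↦ ?_,
        fun c hc y t ↦ component_avg_some i₀ i c hc y t⟩
      rw [← sum_component_some hp hq hpodd hpq i₀ i y]
      exact Fintype.sum_equiv (finCongr hm.symm) _ _ fun _ ↦ rfl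

theorem not_translation_component (hp : p.Prime) (hq : q.Prime) (hpodd : Odd p)
    (hqodd : Odd q) (hpq : p ≠ q) (i₀ : Fin r) (y : Fin r → ZMod (2 * p * q))
    (hy : ∀ x, ∑ c, (if c = none then -1 else 1) * component p q i₀ c x =
      ∑ c, component p q i₀ c (x + y)) : False := by
  simp only [Fintype.sum_option, if_true, reduceCtorEq, if_false, one_mul] at hy
  have hp3 : 3 ≤ p := by have := hp.two_le; obtain ⟨k, hk⟩ := hpodd; lia
  have hq3 : 3 ≤ q := by have := hq.two_le; obtain ⟨k, hk⟩ := hqodd; lia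
  have hshift : ∀ x, ∑ i, component p q i₀ (some i) x =
      ∑ i, component p q i₀ (some i) (x + y) := fun x ↦ by
    have h := sum_congr rfl fun t (_ : t ∈ (univ : Finset (Fin q))) ↦
      hy (x + Pi.single i₀ ((2 * p * t : ℕ) : ZMod (2 * p * q)))
    simp only [add_right_comm _ _ y, component_avg_none, sum_add_distrib, ← mul_sum,
      sum_component_none hp hq hqodd hpq, sum_const, zero_add, mul_zero] at h
    simpa [hq.ne_zero] using h
  have hsome := hshift 0
  rw [zero_add] at hsome
  have hnone := hy 0
  rw [hsome, zero_add] at hnone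
  have hle : ∀ i ∈ (univ : Finset (Fin r)),
      component p q i₀ (some i) y ≤ component p q i₀ (some i) 0 := fun i _ ↦ by
    simp only [component, paritySign, ramanujanSum, Pi.zero_apply, map_zero, if_true]
    split_ifs <;> lia
  have hpar : ∀ i, paritySign (reduce 2 (⟨p * q, by ring⟩ : 2 ∣ 2 * p * q) (y i)) = 1 := fun i ↦ by
    have h := (sum_eq_sum_iff_of_le hle).mp hsome.symm i (mem_univ i)
    simp only [component, paritySign, ramanujanSum, Pi.zero_apply, map_zero, if_true] at h ⊢
    split_ifs at h ⊢ <;> lia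
  simp only [component, hpar, prod_const_one, Pi.zero_apply, map_zero] at hnone
  simp only [paritySign, ramanujanSum, if_true, prod_const_one] at hnone
  split_ifs at hnone <;> lia

end

theorem stmt17 (p q : ℕ) (hp : p.Prime) (hq : q.Prime)
    (hpodd : Odd p) (hqodd : Odd q) (hpq : p ≠ q)
    (r : ℕ) (hr : 1 ≤ r) [NeZero (2 * p * q)] :
    ∃ f g : (Fin r → ZMod (2 * p * q)) → ℂ,
      (∀ x, ∃ Q : ℚ, f x = (Q : ℂ)) ∧
      (∀ x, ∃ Q : ℚ, g x = (Q : ℂ)) ∧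
      (∀ m : ℕ, m + 1 ≤ 3 * r + 2 → ∀ x : Fin m → (Fin r → ZMod (2 * p * q)),
        autocorr f x = autocorr g x) ∧
      ¬ ∃ y : Fin r → ZMod (2 * p * q), ∀ x, g x = f (x + y) := by
  refine ⟨_, _, fun x ↦ ⟨_, (Rat.cast_intCast _).symm⟩, fun x ↦ ⟨_, (Rat.cast_intCast _).symm⟩,
    fun m hm x ↦ (isSeparatedFamily_component hp hq hpodd hqodd hpq ⟨0, hr⟩).autocorr_eq hm x, ?_⟩
  rintro ⟨y, hy⟩
  exact not_translation_component hp hq hpodd hqodd hpq ⟨0, hr⟩ y fun x ↦ by exact_mod_cast hy x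
end
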